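/- arXiv:1804.01360 — 2 statements merged into one kernel-verified Lean document; each statement's English description precedes it below -/
import Mathlib

section
/- Let p > 3 be prime. The number of orbits of the conjugation action of Aut(M₁) (viewed as a subgroup of Hol(M₁)) on the set of regular subgroups of Hol(M₁) that are isomorphic to M₁ equals 2p² − p + 3. (Equivalently, up to isomorphism there are exactly 2p² − p + 3 skew braces with multiplicative group M₁ and additive group M₁.) -/
/-! ## The Heisenberg group of order `p³` -/

@[ext]
structure Heisenberg (p : ℕ) where
  x : ZMod p
  y : ZMod p
  z : ZMod p

namespace Heisenberg

variable {p : ℕ}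

instance : Mul (Heisenberg p) :=
  ⟨fun g h => ⟨g.x + h.x, g.y + h.y, g.z + h.z + h.x * g.y⟩⟩

instance : One (Heisenberg p) := ⟨⟨0, 0, 0⟩⟩

instance : Inv (Heisenberg p) := ⟨fun g => ⟨-g.x, -g.y, -g.z + g.x * g.y⟩⟩

@[simp] theorem mul_x (g h : Heisenberg p) : (g * h).x = g.x + h.x := rfl
@[simp] theorem mul_y (g h : Heisenberg p) : (g * h).y = g.y + h.y := rfl
@[simp] theorem mul_z (g h : Heisenberg p) : (g * h).z = g.z + h.z + h.x * g.y := rfl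
@[simp] theorem one_x : (1 : Heisenberg p).x = 0 := rfl
@[simp] theorem one_y : (1 : Heisenberg p).y = 0 := rfl
@[simp] theorem one_z : (1 : Heisenberg p).z = 0 := rfl
@[simp] theorem inv_x (g : Heisenberg p) : (g⁻¹).x = -g.x := rfl
@[simp] theorem inv_y (g : Heisenberg p) : (g⁻¹).y = -g.y := rfl
@[simp] theorem inv_z (g : Heisenberg p) : (g⁻¹).z = -g.z + g.x * g.y := rfl

instance : Group (Heisenberg p) where
  mul_assoc a b c := by ext <;> simp <;> ring
  one_mul a := by ext <;> simp
  mul_one a := by ext <;> simp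
  inv_mul_cancel a := by ext <;> simp <;> ring

/-- The generator `ρ` (a generator of the centre). -/
def ρ : Heisenberg p := ⟨0, 0, 1⟩

/-- The generator `σ`. -/
def σ : Heisenberg p := ⟨1, 0, 0⟩

/-- The generator `τ`. -/
def τ : Heisenberg p := ⟨0, 1, 0⟩

/-- The automorphism `α₁` determined by `σ ↦ ρσ`, `τ ↦ τ` (and `ρ ↦ ρ`). -/
def α₁ : MulAut (Heisenberg p) where
  toFun g := ⟨g.x, g.y, g.z + g.x⟩
  invFun g := ⟨g.x, g.y, g.z - g.x⟩
  left_inv g := by ext <;> simp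
  right_inv g := by ext <;> simp
  map_mul' g h := by ext <;> simp <;> ring

/-- The automorphism `α₃` determined by `σ ↦ σ`, `τ ↦ ρτ` (and `ρ ↦ ρ`). -/
def α₃ : MulAut (Heisenberg p) where
  toFun g := ⟨g.x, g.y, g.z + g.y⟩
  invFun g := ⟨g.x, g.y, g.z - g.y⟩
  left_inv g := by ext <;> simp
  right_inv g := by ext <;> simp
  map_mul' g h := by ext <;> simp <;> ring

/-- The automorphism `α₂` determined by `σ ↦ στ`, `τ ↦ τ` (and `ρ ↦ ρ`), for `p` an odd
prime. -/
def α₂ (p : ℕ) [Fact p.Prime] (hp : p ≠ 2) : MulAut (Heisenberg p) where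
  toFun g := ⟨g.x, g.x + g.y, g.z + g.x * (g.x - 1) / 2⟩
  invFun g := ⟨g.x, g.y - g.x, g.z - g.x * (g.x - 1) / 2⟩
  left_inv g := by ext <;> simp <;> ring
  right_inv g := by ext <;> simp <;> ring
  map_mul' g h := by
    have h2 : (2 : ZMod p) ≠ 0 := by
      intro h
      have h' : ((2 : ℕ) : ZMod p) = 0 := by exact_mod_cast h
      rw [CharP.cast_eq_zero_iff (ZMod p) p 2] at h'
      have h1 := Nat.le_of_dvd (by norm_num) h'
      have h2 := (Fact.out : p.Prime).two_le
      omega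
    ext <;> simp
    · ring
    · field_simp
      ring

end Heisenberg

open Heisenberg

/-! ## The holomorph of `M₁` inside the permutation group -/

/-- The left regular representation `M₁ → Perm M₁`. -/
def leftMulHom (p : ℕ) : Heisenberg p →* Equiv.Perm (Heisenberg p) :=
  MulAction.toPermHom (Heisenberg p) (Heisenberg p)

/-- The holomorph of `M₁`, realized as the subgroup of `Perm M₁` generated by left
translations and automorphisms of `M₁`. -/
def Hol (p : ℕ) : Subgroup (Equiv.Perm (Heisenberg p)) :=
  (leftMulHom p).range ⊔
    (MulAut.toPerm (Heisenberg p)).range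

/-- A subgroup of `Perm X` is regular if it acts freely and transitively on `X`. -/
def IsRegularSub {X : Type*} (H : Subgroup (Equiv.Perm X)) : Prop :=
  ∀ x y : X, ∃! g : Equiv.Perm X, g ∈ H ∧ g x = y

/-- The canonical projection `Θ : Hol(M₁) → Aut(M₁)` (with kernel the left translations),
written as a function on permutations: it sends `π` to `m ↦ (π 1)⁻¹ * π m`; on elements of the
holomorph, this is exactly the automorphism component. -/
def theta (p : ℕ) (π : Equiv.Perm (Heisenberg p)) : Equiv.Perm (Heisenberg p) :=
  (Equiv.mulLeft (π 1))⁻¹ * π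

/-- The cardinality of the image `Θ(G)` of a subgroup `G` of the holomorph under the canonical
projection `Θ`. -/
noncomputable def thetaCard (p : ℕ) (G : Subgroup (Equiv.Perm (Heisenberg p))) : ℕ :=
  Nat.card (theta p '' (G : Set (Equiv.Perm (Heisenberg p))))

/-- The conjugation action of `Aut(M₁)` (viewed inside `Perm M₁`) on subgroups of `Perm M₁`. -/
def autConj (p : ℕ) (α : MulAut (Heisenberg p)) (G : Subgroup (Equiv.Perm (Heisenberg p))) :
    Subgroup (Equiv.Perm (Heisenberg p)) :=
  Subgroup.map (MulAut.conj (MulAut.toPerm (Heisenberg p) α)).toMonoidHom G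

section Gamma

variable {N : Type*} [Group N]

/-- The permutation `w ↦ a * φ w`. -/
def affinePerm (a : N) (φ : MulAut N) : Equiv.Perm N :=
  Equiv.mulLeft a * MulAut.toPerm N φ

@[simp] theorem affinePerm_apply (a : N) (φ : MulAut N) (w : N) :
    affinePerm a φ w = a * φ w := rfl

theorem affinePerm_mul (a b : N) (φ ψ : MulAut N) :
    affinePerm a φ * affinePerm b ψ = affinePerm (a * φ b) (φ * ψ) := by
  ext w; simp [mul_assoc]

theorem affinePerm_inj {a b : N} {φ ψ : MulAut N} (h : affinePerm a φ = affinePerm b ψ) :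
    a = b ∧ φ = ψ := by
  have hab : a = b := by simpa using Equiv.congr_fun h 1
  refine ⟨hab, MulEquiv.ext fun w => ?_⟩
  simpa [hab] using Equiv.congr_fun h w

/-- The functional equation of the `λ`-map of a skew brace. -/
def IsGamma (lam : N → MulAut N) : Prop := ∀ a b, lam (a * lam a b) = lam a * lam b

theorem IsGamma.map_one {lam : N → MulAut N} (h : IsGamma lam) : lam 1 = 1 := by
  have := h 1 1
  simpa using this

/-- The subgroup of permutations attached to a `λ`-map. -/
def gammaSub (lam : N → MulAut N) (h : IsGamma lam) : Subgroup (Equiv.Perm N) where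
  carrier := Set.range fun a => affinePerm a (lam a)
  mul_mem' := by
    rintro _ _ ⟨a, rfl⟩ ⟨b, rfl⟩
    exact ⟨a * lam a b, by simp only [affinePerm_mul, h a b]⟩
  one_mem' := ⟨1, by ext; simp [h.map_one]⟩
  inv_mem' := by
    rintro _ ⟨a, rfl⟩
    have hb : a * lam a ((lam a)⁻¹ a⁻¹) = 1 := by simp
    refine ⟨(lam a)⁻¹ a⁻¹, eq_inv_of_mul_eq_one_right ?_⟩
    simp only [affinePerm_mul]
    rw [← h, hb, h.map_one]
    ext; simp

theorem affinePerm_mem_gammaSub {lam : N → MulAut N} (h : IsGamma lam) (a : N) :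
    affinePerm a (lam a) ∈ gammaSub lam h := ⟨a, rfl⟩

theorem eq_of_affinePerm_mem_gammaSub {lam : N → MulAut N} (h : IsGamma lam) {a : N}
    {φ : MulAut N} (ha : affinePerm a φ ∈ gammaSub lam h) : φ = lam a := by
  obtain ⟨b, hb⟩ := ha
  obtain ⟨rfl, hφ⟩ := affinePerm_inj hb
  exact hφ.symm

theorem isRegularSub_gammaSub {lam : N → MulAut N} (h : IsGamma lam) :
    IsRegularSub (gammaSub lam h) := by
  intro x y
  have key : ∀ z : N, ∀ g ∈ gammaSub lam h, g 1 = z → g = affinePerm z (lam z) := by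
    rintro z _ ⟨a, rfl⟩ rfl
    simp
  refine ⟨affinePerm y (lam y) * (affinePerm x (lam x))⁻¹,
    ⟨mul_mem (affinePerm_mem_gammaSub h y) (inv_mem (affinePerm_mem_gammaSub h x)), ?_⟩, ?_⟩
  · have hx : (affinePerm x (lam x))⁻¹ x = 1 := by
      rw [Equiv.Perm.inv_eq_iff_eq]; simp
    rw [Equiv.Perm.mul_apply, hx]; simp
  · rintro g ⟨hg, rfl⟩
    rw [eq_mul_inv_iff_mul_eq]
    exact key _ _ (mul_mem hg (affinePerm_mem_gammaSub h x)) (by simp)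

/-- The points of `N` are in bijection with the elements of the subgroup of a `λ`-map. -/
def gammaSubEquiv (lam : N → MulAut N) (h : IsGamma lam) : N ≃ gammaSub lam h where
  toFun a := ⟨affinePerm a (lam a), a, rfl⟩
  invFun g := g.1 1
  left_inv a := by simp
  right_inv := by
    rintro ⟨_, a, rfl⟩
    simp

theorem gammaSubEquiv_mul (lam : N → MulAut N) (h : IsGamma lam) (a b : N) :
    gammaSubEquiv lam h (a * lam a b) = gammaSubEquiv lam h a * gammaSubEquiv lam h b := by
  apply Subtype.ext
  change affinePerm _ _ = affinePerm _ _ * affinePerm _ _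
  rw [affinePerm_mul, h]

theorem nonempty_gammaSub_mulEquiv_iff (lam : N → MulAut N) (h : IsGamma lam)
    {M : Type*} [Group M] :
    Nonempty (gammaSub lam h ≃* M) ↔ ∃ e : N ≃ M, ∀ a b, e (a * lam a b) = e a * e b := by
  constructor
  · rintro ⟨e⟩
    exact ⟨(gammaSubEquiv lam h).trans e.toEquiv, fun a b => by simp [gammaSubEquiv_mul]⟩
  · rintro ⟨e, he⟩
    refine ⟨MulEquiv.mk' ((gammaSubEquiv lam h).symm.trans e) fun g g' => ?_⟩
    obtain ⟨a, rfl⟩ := (gammaSubEquiv lam h).surjective g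
    obtain ⟨b, rfl⟩ := (gammaSubEquiv lam h).surjective g'
    rw [← gammaSubEquiv_mul]
    simp [he]

/-- Transport of a `λ`-map along an automorphism. -/
def conjGamma (α : MulAut N) (lam : N → MulAut N) : N → MulAut N :=
  fun v => α * lam (α⁻¹ v) * α⁻¹

theorem IsGamma.conjGamma {lam : N → MulAut N} (h : IsGamma lam) (α : MulAut N) :
    IsGamma (conjGamma α lam) := by
  intro a b
  have : α⁻¹ (a * (α * lam (α⁻¹ a) * α⁻¹) b) = α⁻¹ a * lam (α⁻¹ a) (α⁻¹ b) := by
    simp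
  simp only [_root_.conjGamma]
  rw [this, h]
  group

/-- Conjugation of subgroups corresponds to transport of `λ`-maps. -/
theorem map_conj_gammaSub {lam lam' : N → MulAut N} (h : IsGamma lam) (h' : IsGamma lam')
    (α : MulAut N) :
    (gammaSub lam h).map (MulAut.conj (MulAut.toPerm N α)).toMonoidHom = gammaSub lam' h' ↔
      ∀ v, lam' (α v) * α = α * lam v := by
  have key : ∀ v, (MulAut.conj (MulAut.toPerm N α)).toMonoidHom (affinePerm v (lam v)) =
      affinePerm (α v) (α * lam v * α⁻¹) := by
    intro v
    ext w
    change α (v * lam v (α⁻¹ w)) = α v * α (lam v (α⁻¹ w))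
    simp
  constructor
  · intro hG v
    have : affinePerm (α v) (α * lam v * α⁻¹) ∈ gammaSub lam' h' := by
      rw [← hG, ← key]
      exact Subgroup.mem_map_of_mem _ (affinePerm_mem_gammaSub h v)
    rw [← eq_of_affinePerm_mem_gammaSub h' this]
    group
  · intro hl
    have hl' : ∀ v, α * lam v * α⁻¹ = lam' (α v) := fun v => by rw [← hl]; group
    ext π
    constructor
    · rintro ⟨_, ⟨v, rfl⟩, rfl⟩
      change (MulAut.conj (MulAut.toPerm N α)).toMonoidHom (affinePerm v (lam v)) ∈ _
      rw [key, hl']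
      exact affinePerm_mem_gammaSub h' _
    · rintro ⟨v, rfl⟩
      refine ⟨affinePerm (α⁻¹ v) (lam (α⁻¹ v)), affinePerm_mem_gammaSub h _, ?_⟩
      rw [key, hl']
      simp

end Gamma

theorem exists_affinePerm_of_mem_Hol {p : ℕ} {π : Equiv.Perm (Heisenberg p)} (h : π ∈ Hol p) :
    ∃ a φ, π = affinePerm a φ := by
  have hinv : ∀ (a : Heisenberg p) (φ : MulAut (Heisenberg p)),
      (affinePerm a φ)⁻¹ = affinePerm (φ⁻¹ a⁻¹) φ⁻¹ := by
    intro a φ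
    refine inv_eq_of_mul_eq_one_right ?_
    rw [affinePerm_mul]
    ext <;> simp
  let S : Subgroup (Equiv.Perm (Heisenberg p)) :=
    { carrier := {π | ∃ a φ, π = affinePerm a φ}
      mul_mem' := by
        rintro _ _ ⟨a, φ, rfl⟩ ⟨b, ψ, rfl⟩
        exact ⟨_, _, affinePerm_mul _ _ _ _⟩
      one_mem' := ⟨1, 1, by ext <;> simp⟩
      inv_mem' := by
        rintro _ ⟨a, φ, rfl⟩
        exact ⟨_, _, hinv a φ⟩ }
  have hS : Hol p ≤ S := by
    refine sup_le ?_ ?_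
    · rintro _ ⟨a, rfl⟩
      exact ⟨a, 1, rfl⟩
    · rintro _ ⟨φ, rfl⟩
      exact ⟨1, φ, Equiv.ext fun w => (one_mul (φ w)).symm⟩
  exact hS h

theorem gammaSub_le_Hol {p : ℕ} {lam : Heisenberg p → MulAut (Heisenberg p)} (h : IsGamma lam) :
    gammaSub lam h ≤ Hol p := by
  rintro _ ⟨a, rfl⟩
  exact mul_mem (Subgroup.mem_sup_left ⟨a, rfl⟩) (Subgroup.mem_sup_right ⟨lam a, rfl⟩)

theorem exists_gammaSub_eq {p : ℕ} {G : Subgroup (Equiv.Perm (Heisenberg p))} (hG : G ≤ Hol p)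
    (hr : IsRegularSub G) : ∃ lam, ∃ h : IsGamma lam, gammaSub lam h = G := by
  have hex : ∀ a : Heisenberg p, ∃ φ, affinePerm a φ ∈ G := by
    intro a
    obtain ⟨g, ⟨hg, hga⟩, -⟩ := hr 1 a
    obtain ⟨b, φ, rfl⟩ := exists_affinePerm_of_mem_Hol (hG hg)
    refine ⟨φ, ?_⟩
    have : b = a := by simpa using hga
    rwa [← this]
  choose lam hlam using hex
  have huniq : ∀ a φ, affinePerm a φ ∈ G → φ = lam a := fun a φ h =>
    (affinePerm_inj ((hr 1 a).unique ⟨h, by simp⟩ ⟨hlam a, by simp⟩)).2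
  have h : IsGamma lam := by
    intro a b
    refine (huniq _ _ ?_).symm
    rw [← affinePerm_mul]
    exact mul_mem (hlam a) (hlam b)
  refine ⟨lam, h, ?_⟩
  ext π
  constructor
  · rintro ⟨a, rfl⟩
    exact hlam a
  · intro hπ
    obtain ⟨a, φ, rfl⟩ := exists_affinePerm_of_mem_Hol (hG hπ)
    rw [huniq a φ hπ]
    exact affinePerm_mem_gammaSub h a

namespace Heisenberg

variable {p : ℕ}

/-- The coordinates of an element of the Heisenberg group. -/
def coordEquiv (p : ℕ) : Heisenberg p ≃ ZMod p × ZMod p × ZMod p where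
  toFun g := (g.x, g.y, g.z)
  invFun v := ⟨v.1, v.2.1, v.2.2⟩
  left_inv _ := rfl
  right_inv _ := rfl

instance [NeZero p] : Finite (Heisenberg p) := Finite.of_equiv _ (coordEquiv p).symm

theorem natCard_eq [NeZero p] : Nat.card (Heisenberg p) = p ^ 3 := by
  rw [Nat.card_congr (coordEquiv p)]
  simp [Nat.card_eq_fintype_card, ZMod.card]
  ring

/-- A predicate on the Heisenberg group that is closed under multiplication twisted by unipotent
maps holds everywhere as soon as it holds at representatives of the generators. -/
theorem forall_of_generators [NeZero p] (t m n : Heisenberg p → ZMod p) (P : Heisenberg p → Prop)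
    (hP : ∀ a b, P a → P b → P ⟨a.x + b.x, a.y + b.y + 2 * t a * b.x,
      a.z + b.z + n a * b.x + m a * b.y + t a * b.x ^ 2 + b.x * a.y⟩)
    (u v : Heisenberg p) (hux : u.x = 1) (hvx : v.x = 0) (hvy : v.y = 1) (hu : P u) (hv : P v)
    (hρ : P ⟨0, 0, 1⟩) (g : Heisenberg p) : P g := by
  have hcast : ∀ z : ZMod p, ∃ k : ℕ, z = (k : ZMod p) + 1 := fun z =>
    ⟨(z - 1).val, by simp⟩
  have hz : ∀ z, P ⟨0, 0, z⟩ := by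
    intro z
    obtain ⟨k, rfl⟩ := hcast z
    induction k with
    | zero => simpa using hρ
    | succ k ih =>
      have := hP _ _ ih hρ
      simpa using this
  have hyz : ∀ y z, P ⟨0, y, z⟩ := by
    intro y
    have : ∃ z, P ⟨0, y, z⟩ := by
      obtain ⟨k, rfl⟩ := hcast y
      induction k with
      | zero => exact ⟨v.z, by convert hv <;> simp [*]⟩
      | succ k ih =>
        obtain ⟨z, ih⟩ := ih
        have := hP _ _ ih hv
        simp only [hvx, hvy] at this
        exact ⟨_, by simpa using this⟩
    obtain ⟨z, h⟩ := this
    intro z'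
    have := hP _ _ h (hz (z' - z))
    simpa using this
  have hx : ∀ x, ∃ y z, P ⟨x, y, z⟩ := by
    intro x
    obtain ⟨k, rfl⟩ := hcast x
    induction k with
    | zero => exact ⟨u.y, u.z, by convert hu; simp [*]⟩
    | succ k ih =>
      obtain ⟨y, z, ih⟩ := ih
      have := hP _ _ ih hu
      simp only [hux] at this
      exact ⟨_, _, by simpa using this⟩
  obtain ⟨x, y, z⟩ := g
  obtain ⟨y', z', h⟩ := hx x
  have := hP _ _ h (hyz (y - y') (z - z' - m ⟨x, y', z'⟩ * (y - y')))
  simp only [mul_zero, add_zero, zero_mul, zero_pow two_ne_zero] at this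
  convert this using 2 <;> ring

theorem commute_iff {g h : Heisenberg p} : g * h = h * g ↔ h.x * g.y = g.x * h.y := by
  constructor
  · intro e
    have := congrArg Heisenberg.z e
    simp only [mul_z] at this
    linear_combination this
  · intro e
    ext <;> simp only [mul_x, mul_y, mul_z]
    · ring
    · ring
    · linear_combination e

/-- The automorphism `x ↦ x`, `y ↦ y + 2tx`, acting unipotently along the centre. -/
def uni (t m n : ZMod p) : MulAut (Heisenberg p) where
  toFun g := ⟨g.x, g.y + 2 * t * g.x, g.z + n * g.x + m * g.y + t * g.x ^ 2⟩
  invFun g := ⟨g.x, g.y - 2 * t * g.x,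
    g.z - n * g.x - m * (g.y - 2 * t * g.x) - t * g.x ^ 2⟩
  left_inv g := by ext <;> simp; ring
  right_inv g := by ext <;> simp; ring
  map_mul' g h := by ext <;> simp <;> ring

@[simp] theorem uni_x (t m n : ZMod p) (g : Heisenberg p) : (uni t m n g).x = g.x := rfl
@[simp] theorem uni_y (t m n : ZMod p) (g : Heisenberg p) :
    (uni t m n g).y = g.y + 2 * t * g.x := rfl
@[simp] theorem uni_z (t m n : ZMod p) (g : Heisenberg p) :
    (uni t m n g).z = g.z + n * g.x + m * g.y + t * g.x ^ 2 := rfl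

theorem uni_mul (t m n t' m' n' : ZMod p) :
    uni t m n * uni t' m' n' = uni (t + t') (m + m') (n + n' + 2 * m * t') := by
  ext g <;> simp <;> ring

variable [Fact p.Prime] [Fact (3 < p)]

instance neZero_two : NeZero (2 : ZMod p) := ⟨by
  have h : 3 < p := Fact.out
  have := (ZMod.natCast_eq_zero_iff 2 p).not.mpr (Nat.not_dvd_of_pos_of_lt (by norm_num) (by omega))
  exact_mod_cast this⟩

instance neZero_three : NeZero (3 : ZMod p) := ⟨by
  have h : 3 < p := Fact.out
  have := (ZMod.natCast_eq_zero_iff 3 p).not.mpr (Nat.not_dvd_of_pos_of_lt (by norm_num) (by omega))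
  exact_mod_cast this⟩

theorem uni_inj {t m n t' m' n' : ZMod p} (h : uni t m n = uni t' m' n') :
    t = t' ∧ m = m' ∧ n = n' := by
  have h1 := congrArg Heisenberg.y (DFunLike.congr_fun h ⟨1, 0, 0⟩)
  have h2 := congrArg Heisenberg.z (DFunLike.congr_fun h ⟨1, 0, 0⟩)
  have h3 := congrArg Heisenberg.z (DFunLike.congr_fun h ⟨0, 1, 0⟩)
  simp only [uni_y, uni_z, mul_one, mul_zero, zero_add, add_zero, one_pow, ne_eq,
    OfNat.ofNat_ne_zero, not_false_eq_true, zero_pow] at h1 h2 h3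
  have ht : t = t' := mul_left_cancel₀ two_ne_zero h1
  exact ⟨ht, h3, by simpa [ht] using h2⟩

/-- The endomorphism acting by the matrix `!![a, b; c, d]` modulo the centre. -/
def endHom (a b c d f g : ZMod p) : Heisenberg p →* Heisenberg p where
  toFun v := ⟨a * v.x + b * v.y, c * v.x + d * v.y, (a * d - b * c) * v.z +
    (a * c * v.x ^ 2 + b * d * v.y ^ 2) / 2 + b * c * v.x * v.y + f * v.x + g * v.y⟩
  map_one' := by ext <;> simp
  map_mul' v w := by
    ext <;> simp only [mul_x, mul_y, mul_z]
    · ring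
    · ring
    · have h2 : (2 : ZMod p) ≠ 0 := two_ne_zero
      field_simp
      ring

@[simp] theorem endHom_x (a b c d f g : ZMod p) (v : Heisenberg p) :
    (endHom a b c d f g v).x = a * v.x + b * v.y := rfl
@[simp] theorem endHom_y (a b c d f g : ZMod p) (v : Heisenberg p) :
    (endHom a b c d f g v).y = c * v.x + d * v.y := rfl
@[simp] theorem endHom_z (a b c d f g : ZMod p) (v : Heisenberg p) :
    (endHom a b c d f g v).z = (a * d - b * c) * v.z +
    (a * c * v.x ^ 2 + b * d * v.y ^ 2) / 2 + b * c * v.x * v.y + f * v.x + g * v.y := rfl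

/-- The automorphism acting by the invertible matrix `!![a, b; c, d]` modulo the centre. -/
noncomputable def mkAut (a b c d f g : ZMod p) (h : a * d - b * c ≠ 0) : MulAut (Heisenberg p) :=
  MulEquiv.ofBijective (endHom a b c d f g) (by
    rw [← Finite.injective_iff_bijective, injective_iff_map_eq_one]
    intro v hv
    have hx := congrArg Heisenberg.x hv
    have hy := congrArg Heisenberg.y hv
    have hz := congrArg Heisenberg.z hv
    simp only [endHom_x, endHom_y, endHom_z, one_x, one_y, one_z] at hx hy hz
    have hx0 : v.x = 0 := by
      apply mul_left_cancel₀ h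
      linear_combination d * hx - b * hy
    have hy0 : v.y = 0 := by
      apply mul_left_cancel₀ h
      linear_combination a * hy - c * hx
    have hz0 : v.z = 0 := by
      apply mul_left_cancel₀ h
      simpa [hx0, hy0] using hz
    ext <;> simp [hx0, hy0, hz0])

@[simp] theorem mkAut_apply (a b c d f g : ZMod p) (h : a * d - b * c ≠ 0) (v : Heisenberg p) :
    mkAut a b c d f g h v = endHom a b c d f g v := rfl

/-- Every automorphism is given by a matrix and a linear form. -/
theorem exists_eq_mkAut (α : MulAut (Heisenberg p)) :
    ∃ a b c d f g, ∃ h : a * d - b * c ≠ 0, α = mkAut a b c d f g h := by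
  set u := α ⟨1, 0, 0⟩ with hu
  set v := α ⟨0, 1, 0⟩ with hv
  have hrel : (⟨0, 1, 0⟩ * ⟨1, 0, 0⟩ : Heisenberg p) = ⟨0, 0, 1⟩ * (⟨1, 0, 0⟩ * ⟨0, 1, 0⟩) := by
    ext <;> simp
  have hρ : v * u = α ⟨0, 0, 1⟩ * (u * v) := by
    rw [hu, hv, ← map_mul, ← map_mul, ← map_mul, hrel]
  have hρ' : α ⟨0, 0, 1⟩ = ⟨0, 0, u.x * v.y - v.x * u.y⟩ := by
    rw [← mul_inv_eq_iff_eq_mul] at hρ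
    rw [← hρ]
    ext <;> simp <;> ring
  have hdet : u.x * v.y - v.x * u.y ≠ 0 := by
    intro h0
    rw [h0] at hρ'
    have : α ⟨0, 0, 1⟩ = α 1 := by rw [hρ', map_one]; rfl
    have := congrArg Heisenberg.z (α.injective this)
    simp at this
  refine ⟨u.x, v.x, u.y, v.y, u.z - u.x * u.y / 2, v.z - v.x * v.y / 2, hdet,
    MulEquiv.ext fun w => ?_⟩
  refine forall_of_generators 0 0 0 (fun w => α w = mkAut _ _ _ _ _ _ hdet w) ?_
    ⟨1, 0, 0⟩ ⟨0, 1, 0⟩ rfl rfl rfl ?_ ?_ ?_ w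
  · intro w w' h h'
    have : (⟨w.x + w'.x, w.y + w'.y + 2 * (0 : Heisenberg p → ZMod p) w * w'.x, w.z + w'.z +
        (0 : Heisenberg p → ZMod p) w * w'.x + (0 : Heisenberg p → ZMod p) w * w'.y +
        (0 : Heisenberg p → ZMod p) w * w'.x ^ 2 + w'.x * w.y⟩ : Heisenberg p) = w * w' := by
      ext <;> simp
    rw [this, map_mul, map_mul, h, h']
  · rw [← hu]; ext <;> simp
  · rw [← hv]; ext <;> simp
  · rw [hρ']; ext <;> simp

end Heisenberg

namespace Heisenberg

variable {p : ℕ}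

/-- The operation `a ∘ b = a * lam a b` makes the Heisenberg group into a group isomorphic to
itself. -/
def IsHeisenbergGamma (lam : Heisenberg p → MulAut (Heisenberg p)) : Prop :=
  ∃ e : Heisenberg p ≃ Heisenberg p, ∀ a b, e (a * lam a b) = e a * e b

/-- Two `λ`-maps are related when an automorphism transports one to the other. -/
def GammaRel (lam lam' : Heisenberg p → MulAut (Heisenberg p)) : Prop :=
  ∃ α : MulAut (Heisenberg p), ∀ v, lam' (α v) * α = α * lam v

theorem GammaRel.symm {lam lam' : Heisenberg p → MulAut (Heisenberg p)} (h : GammaRel lam lam') :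
    GammaRel lam' lam := by
  obtain ⟨α, hα⟩ := h
  refine ⟨α⁻¹, fun v => ?_⟩
  have := hα (α⁻¹ v)
  rw [MulAut.apply_inv_self] at this
  rw [mul_inv_eq_iff_eq_mul, mul_assoc, this, inv_mul_cancel_left]

theorem GammaRel.trans {lam lam' lam'' : Heisenberg p → MulAut (Heisenberg p)}
    (h : GammaRel lam lam') (h' : GammaRel lam' lam'') : GammaRel lam lam'' := by
  obtain ⟨α, hα⟩ := h
  obtain ⟨β, hβ⟩ := h'
  refine ⟨β * α, fun v => ?_⟩
  rw [MulAut.mul_apply, ← mul_assoc, hβ, mul_assoc, hα, mul_assoc]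

theorem gammaRel_conjGamma (α : MulAut (Heisenberg p))
    (lam : Heisenberg p → MulAut (Heisenberg p)) : GammaRel lam (conjGamma α lam) :=
  ⟨α, fun v => by simp [conjGamma, mul_assoc]⟩

theorem IsHeisenbergGamma.conjGamma {lam : Heisenberg p → MulAut (Heisenberg p)}
    (h : IsHeisenbergGamma lam) (α : MulAut (Heisenberg p)) :
    IsHeisenbergGamma (conjGamma α lam) := by
  obtain ⟨e, he⟩ := h
  refine ⟨α⁻¹.toEquiv.trans e, fun a b => ?_⟩
  change e (α⁻¹ (a * α (lam (α⁻¹ a) (α⁻¹ b)))) = e (α⁻¹ a) * e (α⁻¹ b)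
  rw [map_mul, MulAut.inv_apply_self, he]

/-- The `λ`-map as a homomorphism on the corresponding group of permutations. -/
def gammaHom {lam : Heisenberg p → MulAut (Heisenberg p)} (h : IsGamma lam) :
    gammaSub lam h →* MulAut (Heisenberg p) where
  toFun g := lam (g.1 1)
  map_one' := h.map_one
  map_mul' := by
    rintro ⟨_, a, rfl⟩ ⟨_, b, rfl⟩
    change lam (a * lam a (b * lam b 1)) = lam (a * lam a 1) * lam (b * lam b 1)
    simp only [map_one, mul_one, h a b]

theorem gammaHom_gammaSubEquiv {lam : Heisenberg p → MulAut (Heisenberg p)} (h : IsGamma lam)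
    (v : Heisenberg p) : gammaHom h (gammaSubEquiv lam h v) = lam v := by
  change lam (v * lam v 1) = lam v
  simp

variable [Fact p.Prime]

theorem natCard_gammaSub {lam : Heisenberg p → MulAut (Heisenberg p)} (h : IsGamma lam) :
    Nat.card (gammaSub lam h) = p ^ 3 := by
  rw [← Nat.card_congr (gammaSubEquiv lam h), natCard_eq]

section Circ

variable {c : Heisenberg p → Heisenberg p → Heisenberg p} {e : Heisenberg p ≃ Heisenberg p}
  (he : ∀ a b, e (c a b) = e a * e b)

include he

theorem comm_of_eq_zero {f : Heisenberg p → ZMod p} (hf : ∀ a b, f (c a b) = f a + f b)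
    {u : Heisenberg p} (hu : f u ≠ 0) {a b : Heisenberg p} (ha : f a = 0) (hb : f b = 0) :
    c a b = c b a := by
  have hF : ∀ g h, f (e.symm (g * h)) = f (e.symm g) + f (e.symm h) := by
    intro g h
    rw [← hf]
    congr 1
    rw [Equiv.symm_apply_eq, he]
    simp
  set r := f (e.symm ⟨1, 0, 0⟩)
  set s := f (e.symm ⟨0, 1, 0⟩)
  have hρ : f (e.symm ⟨0, 0, 1⟩) = 0 := by
    have h1 := hF ⟨0, 1, 0⟩ ⟨1, 0, 0⟩
    have h2 := hF ⟨0, 0, 1⟩ (⟨1, 0, 0⟩ * ⟨0, 1, 0⟩)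
    have h3 := hF ⟨1, 0, 0⟩ ⟨0, 1, 0⟩
    have hrel : (⟨0, 1, 0⟩ * ⟨1, 0, 0⟩ : Heisenberg p) =
        ⟨0, 0, 1⟩ * (⟨1, 0, 0⟩ * ⟨0, 1, 0⟩) := by
      ext <;> simp
    rw [hrel] at h1
    linear_combination h1 - h2 - h3
  have hlin : ∀ g : Heisenberg p, f (e.symm g) = r * g.x + s * g.y := by
    intro g
    refine forall_of_generators 0 0 0 (fun g => f (e.symm g) = r * g.x + s * g.y) ?_
      ⟨1, 0, 0⟩ ⟨0, 1, 0⟩ rfl rfl rfl ?_ ?_ ?_ g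
    · intro w w' h h'
      have : (⟨w.x + w'.x, w.y + w'.y + 2 * (0 : Heisenberg p → ZMod p) w * w'.x, w.z + w'.z +
          (0 : Heisenberg p → ZMod p) w * w'.x + (0 : Heisenberg p → ZMod p) w * w'.y +
          (0 : Heisenberg p → ZMod p) w * w'.x ^ 2 + w'.x * w.y⟩ : Heisenberg p) = w * w' := by
        ext <;> simp
      rw [this, hF, h, h', mul_x, mul_y]
      ring
    · simp [r]
    · simp [s]
    · simp [hρ]
  have hlin' : ∀ g, f g = r * (e g).x + s * (e g).y := fun g => by rw [← hlin]; simp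
  rw [hlin'] at hu ha hb
  apply e.injective
  rw [he, he, commute_iff]
  by_cases hr : r = 0
  · have hs : s ≠ 0 := by
      intro hs
      simp [hr, hs] at hu
    apply mul_left_cancel₀ hs
    linear_combination (e b).x * ha - (e a).x * hb
  · apply mul_left_cancel₀ hr
    linear_combination (e a).y * hb - (e b).y * ha

theorem exists_commutator (a b : Heisenberg p) :
    ∃ d, c a b = c d (c b a) ∧ ∀ w, c d w = c w d := by
  refine ⟨e.symm ⟨0, 0, (e b).x * (e a).y - (e a).x * (e b).y⟩, ?_, fun w => ?_⟩
  · apply e.injective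
    simp only [he, Equiv.apply_symm_apply]
    ext <;> simp <;> ring
  · apply e.injective
    rw [he, he, commute_iff]
    simp

theorem not_forall_comm : ¬ ∀ a b, c a b = c b a := by
  intro h
  have := congrArg e (h (e.symm ⟨1, 0, 0⟩) (e.symm ⟨0, 1, 0⟩))
  rw [he, he, commute_iff] at this
  simp at this

end Circ

variable [Fact (3 < p)]

theorem apply_congr_of_xy (φ : MulAut (Heisenberg p)) {v w : Heisenberg p} (hx : v.x = w.x)
    (hy : v.y = w.y) : (φ v).x = (φ w).x ∧ (φ v).y = (φ w).y := by
  obtain ⟨a, b, c, d, f, g, h, rfl⟩ := exists_eq_mkAut φ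
  simp [hx, hy]

/-- The automorphism group acts on the quotient of the Heisenberg group by its centre. -/
@[reducible] def autActionXY (p : ℕ) [Fact p.Prime] [Fact (3 < p)] :
    MulAction (MulAut (Heisenberg p)) (ZMod p × ZMod p) where
  smul φ v := ((φ ⟨v.1, v.2, 0⟩).x, (φ ⟨v.1, v.2, 0⟩).y)
  one_smul _ := rfl
  mul_smul φ ψ v := by
    have := apply_congr_of_xy φ (v := ψ ⟨v.1, v.2, 0⟩)
      (w := ⟨(ψ ⟨v.1, v.2, 0⟩).x, (ψ ⟨v.1, v.2, 0⟩).y, 0⟩) rfl rfl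
    exact Prod.ext this.1 this.2

theorem exists_fixed_xy {lam : Heisenberg p → MulAut (Heisenberg p)} (h : IsGamma lam) :
    ∃ v : Heisenberg p, (v.x ≠ 0 ∨ v.y ≠ 0) ∧ ∀ w, (lam w v).x = v.x ∧ (lam w v).y = v.y := by
  let _ := autActionXY p
  let _ : MulAction (gammaSub lam h) (ZMod p × ZMod p) := MulAction.compHom _ (gammaHom h)
  have hp : IsPGroup p (gammaSub lam h) := IsPGroup.of_card (natCard_gammaSub h)
  have hfix : (0 : ZMod p × ZMod p) ∈ MulAction.fixedPoints (gammaSub lam h) _ := by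
    intro g
    have : gammaHom h g ⟨0, 0, 0⟩ = 1 := map_one (gammaHom h g)
    change ((gammaHom h g ⟨0, 0, 0⟩).x, (gammaHom h g ⟨0, 0, 0⟩).y) = 0
    rw [this]
    rfl
  obtain ⟨b, hb, hne⟩ := hp.exists_fixed_point_of_prime_dvd_card_of_fixed_point
    (ZMod p × ZMod p) (by simp) hfix
  refine ⟨⟨b.1, b.2, 0⟩, ?_, fun w => ?_⟩
  · by_contra! hc
    exact hne (Prod.ext hc.1.symm hc.2.symm)
  · have := hb (gammaSubEquiv lam h w)
    change ((gammaHom h (gammaSubEquiv lam h w) ⟨b.1, b.2, 0⟩).x,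
      (gammaHom h (gammaSubEquiv lam h w) ⟨b.1, b.2, 0⟩).y) = b at this
    rw [gammaHom_gammaSubEquiv] at this
    exact ⟨congrArg Prod.fst this, congrArg Prod.snd this⟩

/-- Every `λ`-map is conjugate to a unipotent one. -/
theorem exists_gammaRel_uni {lam : Heisenberg p → MulAut (Heisenberg p)} (h : IsGamma lam) :
    ∃ α : MulAut (Heisenberg p), ∃ t m n : Heisenberg p → ZMod p,
      conjGamma α lam = fun v => uni (t v) (m v) (n v) := by
  obtain ⟨v, hv, hfix⟩ := exists_fixed_xy h
  obtain ⟨β, hβ⟩ : ∃ β : MulAut (Heisenberg p), (β ⟨0, 1, 0⟩).x = v.x ∧ (β ⟨0, 1, 0⟩).y = v.y := by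
    by_cases hy : v.y = 0
    · have hx : v.x ≠ 0 := hv.resolve_right (not_not.mpr hy)
      exact ⟨mkAut 0 v.x 1 v.y 0 0 (by simpa using hx), by simp⟩
    · exact ⟨mkAut 1 v.x 0 v.y 0 0 (by simpa using hy), by simp⟩
  have h' := h.conjGamma β⁻¹
  have key : ∀ w, ∃ t m n, conjGamma β⁻¹ lam w = uni t m n := by
    intro w
    have hfix' : (conjGamma β⁻¹ lam w ⟨0, 1, 0⟩).x = 0 ∧
        (conjGamma β⁻¹ lam w ⟨0, 1, 0⟩).y = 1 := by
      have h1 := apply_congr_of_xy (lam (β w)) hβ.1 hβ.2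
      have h2 := apply_congr_of_xy β⁻¹ (v := lam (β w) (β ⟨0, 1, 0⟩)) (w := β ⟨0, 1, 0⟩)
        (by rw [h1.1, (hfix _).1, hβ.1]) (by rw [h1.2, (hfix _).2, hβ.2])
      rw [MulAut.inv_apply_self] at h2
      have h3 : conjGamma β⁻¹ lam w ⟨0, 1, 0⟩ = β⁻¹ (lam (β w) (β ⟨0, 1, 0⟩)) := by
        simp [conjGamma]
      rw [h3]
      exact h2
    have hpow : conjGamma β⁻¹ lam w ^ p ^ 3 = 1 := by
      rw [← gammaHom_gammaSubEquiv h', ← map_pow, ← natCard_gammaSub h', pow_card_eq_one',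
        map_one]
    obtain ⟨a, b, c, d, f, g, hdet, hφ⟩ := exists_eq_mkAut (conjGamma β⁻¹ lam w)
    rw [hφ] at hfix' hpow ⊢
    have hb : b = 0 := by simpa using hfix'.1
    have hd : d = 1 := by simpa using hfix'.2
    subst hb hd
    have hx : ∀ k : ℕ, ∀ u, ((mkAut a 0 c 1 f g hdet ^ k) u).x = a ^ k * u.x := by
      intro k
      induction k with
      | zero => simp
      | succ k ih =>
        intro u
        rw [pow_succ, MulAut.mul_apply, ih]
        simp
        ring
    have ha : a = 1 := by
      have := hx (p ^ 3) ⟨1, 0, 0⟩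
      rw [hpow, ZMod.pow_card_pow] at this
      simpa using this.symm
    subst ha
    refine ⟨c / 2, g, f, ?_⟩
    ext u
    · simp
    · simp [field]; ring
    · simp; ring
  choose t m n htmn using key
  exact ⟨β⁻¹, t, m, n, funext htmn⟩

end Heisenberg

namespace Heisenberg

variable {p : ℕ}

theorem isGamma_uni {t m n : Heisenberg p → ZMod p}
    (ht : ∀ a b, t (a * uni (t a) (m a) (n a) b) = t a + t b)
    (hm : ∀ a b, m (a * uni (t a) (m a) (n a) b) = m a + m b)
    (hn : ∀ a b, n (a * uni (t a) (m a) (n a) b) = n a + n b + 2 * m a * t b) :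
    IsGamma fun v => uni (t v) (m v) (n v) := by
  intro a b
  dsimp only
  rw [uni_mul, ht, hm, hn]

theorem mul_uni (a : Heisenberg p) (t m n : ZMod p) (b : Heisenberg p) :
    a * uni t m n b = ⟨a.x + b.x, a.y + b.y + 2 * t * b.x,
      a.z + b.z + n * b.x + m * b.y + t * b.x ^ 2 + b.x * a.y⟩ := by
  ext <;> simp <;> ring

/-- The `λ`-maps that are trivial on the centre. -/
def famA (t m₁ m₂ n₁ n₂ : ZMod p) (v : Heisenberg p) : MulAut (Heisenberg p) :=
  uni (t * v.x) (m₁ * v.x + m₂ * v.y)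
    (n₂ * v.y + t * (m₁ - n₂) * v.x ^ 2 + (n₁ - t * (m₁ - n₂)) * v.x)

theorem isGamma_famA {t m₁ m₂ n₁ n₂ : ZMod p} (h : m₂ * t = 0) :
    IsGamma (famA t m₁ m₂ n₁ n₂) := by
  refine isGamma_uni (t := fun v => t * v.x) (m := fun v => m₁ * v.x + m₂ * v.y)
    (n := fun v => n₂ * v.y + t * (m₁ - n₂) * v.x ^ 2 + (n₁ - t * (m₁ - n₂)) * v.x)
    ?_ ?_ ?_ <;> intro a b <;> simp only [mul_uni]
  · ring
  · linear_combination 2 * a.x * b.x * h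
  · linear_combination (-2) * a.y * b.x * h

variable [Fact p.Prime]

/-- The `λ`-maps that are nontrivial on the centre. -/
def famB (s r : ZMod p) (v : Heisenberg p) : MulAut (Heisenberg p) :=
  uni (s * (2 * v.z - v.x * v.y - r * v.x * (v.x - 1))) (v.x / 2)
    (-v.y / 2 + v.x * (s * (2 * v.z - v.x * v.y - r * v.x * (v.x - 1))) + r * v.x)

theorem forall_eq_of_generators {t m n : Heisenberg p → ZMod p}
    (h : IsGamma fun v => uni (t v) (m v) (n v))
    {lam : Heisenberg p → MulAut (Heisenberg p)} (h' : IsGamma lam)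
    (u v : Heisenberg p) (hux : u.x = 1) (hvx : v.x = 0) (hvy : v.y = 1)
    (hu : uni (t u) (m u) (n u) = lam u) (hv : uni (t v) (m v) (n v) = lam v)
    (hρ : uni (t ⟨0, 0, 1⟩) (m ⟨0, 0, 1⟩) (n ⟨0, 0, 1⟩) = lam ⟨0, 0, 1⟩) :
    (fun v => uni (t v) (m v) (n v)) = lam := by
  funext w
  refine forall_of_generators t m n (fun w => uni (t w) (m w) (n w) = lam w) ?_ u v hux hvx hvy
    hu hv hρ w
  intro a b ha hb
  have := h a b
  simp only at this
  rw [← mul_uni, this, ha, hb, h']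

theorem map_eq_mul_of_add {f : ZMod p → ZMod p} (hf : ∀ x y, f (x + y) = f x + f y)
    (x : ZMod p) : f x = f 1 * x := by
  have h0 : f 0 = 0 := by
    have := hf 0 0
    rw [add_zero] at this
    linear_combination -this
  obtain ⟨k, rfl⟩ := ZMod.natCast_zmod_surjective x
  induction k with
  | zero => simp [h0]
  | succ k ih => rw [Nat.cast_succ, hf, ih]; ring

theorem isHeisenbergGamma_of_injective {lam : Heisenberg p → MulAut (Heisenberg p)}
    (e : Heisenberg p → Heisenberg p) (hinj : Function.Injective e)
    (he : ∀ a b, e (a * lam a b) = e a * e b) : IsHeisenbergGamma lam :=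
  ⟨Equiv.ofBijective e (Finite.injective_iff_bijective.mp hinj), he⟩

variable [Fact (3 < p)]

theorem isHeisenbergGamma_famA {t m₁ m₂ n₁ n₂ : ZMod p} (h : m₂ * t = 0) (h1 : m₁ ≠ n₂ + 1) :
    IsHeisenbergGamma (famA t m₁ m₂ n₁ n₂) := by
  have h2 : (2 : ZMod p) ≠ 0 := two_ne_zero
  have h3 : (3 : ZMod p) ≠ 0 := three_ne_zero
  have hκ : n₂ + 1 - m₁ ≠ 0 := sub_ne_zero.mpr h1.symm
  refine isHeisenbergGamma_of_injective (fun v => ⟨v.x, (n₂ + 1 - m₁) * (v.y - t * v.x ^ 2),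
    v.z - t * (m₁ + 1) * v.x ^ 3 / 3 - (n₁ - t * (m₁ - n₂)) * v.x ^ 2 / 2
      - m₂ * v.y ^ 2 / 2 - m₁ * v.x * (v.y - t * v.x ^ 2)⟩) ?_ ?_
  · intro v w hvw
    simp only [Heisenberg.mk.injEq] at hvw
    obtain ⟨hx, hy, hz⟩ := hvw
    have hy := mul_left_cancel₀ hκ hy
    rw [hx] at hy hz
    have hy : v.y = w.y := by linear_combination hy
    rw [hy] at hz
    have hz : v.z = w.z := by linear_combination hz
    ext <;> assumption
  · intro v w
    simp only [famA, mul_uni]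
    ext <;> simp only [mul_x, mul_y, mul_z]
    · ring
    · field_simp
      linear_combination (-12 * v.x * w.x * (v.y + w.y) - 12 * t * v.x ^ 2 * w.x ^ 2) * h

theorem isGamma_famB (s r : ZMod p) : IsGamma (famB s r) := by
  have h2 : (2 : ZMod p) ≠ 0 := two_ne_zero
  refine isGamma_uni (t := fun v => s * (2 * v.z - v.x * v.y - r * v.x * (v.x - 1)))
    (m := fun v => v.x / 2) (n := fun v => -v.y / 2 +
      v.x * (s * (2 * v.z - v.x * v.y - r * v.x * (v.x - 1))) + r * v.x)
    ?_ ?_ ?_ <;> intro a b <;> simp only [mul_uni] <;> field_simp <;> ring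

theorem isHeisenbergGamma_famB {s : ZMod p} (hs : s ≠ 0) (r : ZMod p) :
    IsHeisenbergGamma (famB s r) := by
  have h2 : (2 : ZMod p) ≠ 0 := two_ne_zero
  refine isHeisenbergGamma_of_injective (fun v => ⟨v.x,
    2 * s * (2 * v.z - v.x * v.y - r * v.x * (v.x - 1)), v.y⟩) ?_ ?_
  · intro v w hvw
    simp only [Heisenberg.mk.injEq] at hvw
    obtain ⟨hx, hy, hz⟩ := hvw
    have hy := mul_left_cancel₀ (mul_ne_zero h2 hs) hy
    rw [hx, hz] at hy
    have hy : v.z = w.z := mul_left_cancel₀ h2 (by linear_combination hy)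
    ext <;> assumption
  · intro v w
    simp only [famB, mul_uni]
    ext <;> simp only [mul_x, mul_y, mul_z]
    · field_simp
      ring
    · ring

/-- Transport of a unipotent automorphism along an arbitrary one. -/
theorem uni_mul_mkAut_iff {a b c d f g : ZMod p} (h : a * d - b * c ≠ 0)
    (t m n t' m' n' : ZMod p) :
    uni t' m' n' * mkAut a b c d f g h = mkAut a b c d f g h * uni t m n ↔
      b * t = 0 ∧ b * t' = 0 ∧ d * t = a * t' ∧ (a * d - b * c) * m = n' * b + m' * d ∧
      (a * d - b * c) * n + 2 * g * t = n' * a + m' * c := by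
  have h2 : (2 : ZMod p) ≠ 0 := two_ne_zero
  constructor
  · intro e
    have ex := congrArg Heisenberg.x (DFunLike.congr_fun e ⟨1, 0, 0⟩)
    have ey := congrArg Heisenberg.y (DFunLike.congr_fun e ⟨1, 0, 0⟩)
    have ez := congrArg Heisenberg.z (DFunLike.congr_fun e ⟨1, 0, 0⟩)
    have ey' := congrArg Heisenberg.y (DFunLike.congr_fun e ⟨0, 1, 0⟩)
    have ez' := congrArg Heisenberg.z (DFunLike.congr_fun e ⟨0, 1, 0⟩)
    simp only [MulAut.mul_apply, mkAut_apply, uni_x, uni_y, uni_z, endHom_x, endHom_y,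
      endHom_z] at ex ey ez ey' ez'
    have h1 : b * t = 0 := mul_left_cancel₀ h2 (by linear_combination -ex)
    have h1' : b * t' = 0 := mul_left_cancel₀ h2 (by linear_combination ey')
    have h3 : d * t = a * t' := mul_left_cancel₀ h2 (by linear_combination -ey)
    refine ⟨h1, h1', h3, ?_, ?_⟩
    · linear_combination -ez' + b * h1'
    · linear_combination -ez - a*h3 - (4*2⁻¹*d*t)*h1 - c*h1
  · rintro ⟨h1, h1', h3, h4, h5⟩
    ext w <;> simp only [MulAut.mul_apply, mkAut_apply, uni_x, uni_y, uni_z, endHom_x, endHom_y,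
      endHom_z]
    · linear_combination (-2) * w.x * h1
    · linear_combination (-2) * w.x * h3 + 2 * w.y * h1'
    · field_simp
      linear_combination (-2) * w.x * h5 - 2 * w.y * h4 - 2 * a * w.x ^ 2 * h3 +
        2 * (2 * a * w.x * w.y + b * w.y ^ 2) * h1' -
        2 * (c * w.x ^ 2 + 2 * d * w.x * w.y + 2 * d * t * w.x ^ 2) * h1

end Heisenberg

namespace Heisenberg

variable {p : ℕ}

/-- The twisted product attached to a family of unipotent automorphisms. -/
def circ (t m n : Heisenberg p → ZMod p) (a b : Heisenberg p) : Heisenberg p :=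
  ⟨a.x + b.x, a.y + b.y + 2 * t a * b.x,
    a.z + b.z + n a * b.x + m a * b.y + t a * b.x ^ 2 + b.x * a.y⟩

variable [Fact p.Prime] [Fact (3 < p)]

section Classification

variable {t m n : Heisenberg p → ZMod p}

theorem IsGamma.circ_add (h : IsGamma fun v => uni (t v) (m v) (n v)) (a b : Heisenberg p) :
    t (circ t m n a b) = t a + t b ∧ m (circ t m n a b) = m a + m b ∧
      n (circ t m n a b) = n a + n b + 2 * m a * t b := by
  have := h a b
  simp only [uni_mul, mul_uni] at this
  exact uni_inj this

variable (h : IsGamma fun v => uni (t v) (m v) (n v)) {e : Heisenberg p ≃ Heisenberg p}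
  (he : ∀ a b, e (circ t m n a b) = e a * e b)

include h he

theorem kernel_formulas : m ⟨0, 1, 0⟩ * t ⟨0, 0, 1⟩ = 0 ∧ ∀ y z,
    m ⟨0, y, z⟩ = m ⟨0, 1, 0⟩ * y ∧ t ⟨0, y, z⟩ = t ⟨0, 1, 0⟩ * y + t ⟨0, 0, 1⟩ * z ∧
    n ⟨0, y, z⟩ = n ⟨0, y, 0⟩ + n ⟨0, 0, 1⟩ * z ∧
    (m ⟨0, 1, 0⟩ = 0 → n ⟨0, y, 0⟩ = n ⟨0, 1, 0⟩ * y) := by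
  have hcirc : ∀ y z y' z', circ t m n ⟨0, y, z⟩ ⟨0, y', z'⟩ =
      ⟨0, y + y', z + z' + m ⟨0, y, z⟩ * y'⟩ := by
    intro y z y' z'
    ext <;> simp [circ]
  have hm : ∀ y z, m ⟨0, y, z⟩ = m ⟨0, 1, 0⟩ * y := by
    intro y z
    have := comm_of_eq_zero he (f := Heisenberg.x) (fun _ _ => rfl) (u := ⟨1, 0, 0⟩)
      one_ne_zero (a := ⟨0, y, z⟩) (b := ⟨0, 1, 0⟩) rfl rfl
    rw [hcirc, hcirc, Heisenberg.mk.injEq] at this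
    linear_combination this.2.2
  have hadd : ∀ y z y' z', t ⟨0, y + y', z + z' + m ⟨0, 1, 0⟩ * y * y'⟩ =
      t ⟨0, y, z⟩ + t ⟨0, y', z'⟩ ∧ n ⟨0, y + y', z + z' + m ⟨0, 1, 0⟩ * y * y'⟩ =
      n ⟨0, y, z⟩ + n ⟨0, y', z'⟩ + 2 * (m ⟨0, 1, 0⟩ * y) * t ⟨0, y', z'⟩ := by
    intro y z y' z'
    have := IsGamma.circ_add h ⟨0, y, z⟩ ⟨0, y', z'⟩
    rw [hcirc, hm] at this
    exact ⟨this.1, this.2.2⟩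
  have h2 : (2 : ZMod p) ≠ 0 := two_ne_zero
  have hmt : m ⟨0, 1, 0⟩ * t ⟨0, 0, 1⟩ = 0 := by
    have h1 := (hadd 0 1 1 0).2
    have h1' := (hadd 1 0 0 1).2
    simp only [zero_add, add_zero, mul_zero, zero_mul] at h1 h1'
    apply mul_left_cancel₀ h2
    linear_combination h1 - h1'
  have ht3 : ∀ z, t ⟨0, 0, z⟩ = t ⟨0, 0, 1⟩ * z := by
    refine map_eq_mul_of_add (f := fun z => t ⟨0, 0, z⟩) fun z z' => ?_
    simpa using (hadd 0 z 0 z').1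
  have hn3 : ∀ z, n ⟨0, 0, z⟩ = n ⟨0, 0, 1⟩ * z := by
    refine map_eq_mul_of_add (f := fun z => n ⟨0, 0, z⟩) fun z z' => ?_
    simpa using (hadd 0 z 0 z').2
  have htz : ∀ y z, t ⟨0, y, z⟩ = t ⟨0, y, 0⟩ + t ⟨0, 0, 1⟩ * z := by
    intro y z
    have := (hadd 0 z y 0).1
    simp only [zero_add, add_zero, mul_zero, zero_mul] at this
    rw [this, ht3, add_comm]
  have hnz : ∀ y z, n ⟨0, y, z⟩ = n ⟨0, y, 0⟩ + n ⟨0, 0, 1⟩ * z := by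
    intro y z
    have := (hadd 0 z y 0).2
    simp only [zero_add, add_zero, mul_zero, zero_mul] at this
    rw [this, hn3, add_comm]
  have ht2 : ∀ y, t ⟨0, y, 0⟩ = t ⟨0, 1, 0⟩ * y := by
    refine map_eq_mul_of_add (f := fun y => t ⟨0, y, 0⟩) fun y y' => ?_
    have := (hadd y 0 y' 0).1
    rw [htz] at this
    linear_combination this - y * y' * hmt
  refine ⟨hmt, fun y z => ⟨hm y z, by rw [htz, ht2], hnz y z, fun hm0 => ?_⟩⟩
  refine map_eq_mul_of_add (f := fun y => n ⟨0, y, 0⟩) (fun y y' => ?_) y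
  have := (hadd y 0 y' 0).2
  simpa [hm0] using this

theorem exists_circ_commutator (a b : Heisenberg p) : ∃ d : Heisenberg p, d.x = 0 ∧ t d = 0 ∧
    m d = 0 ∧ n d = 2 * (m a * t b - m b * t a) ∧
    (circ t m n a b).y = d.y + (circ t m n b a).y ∧
    (circ t m n a b).z = d.z + (circ t m n b a).z + (n d + d.y) * (a.x + b.x) ∧
    ∀ w : Heisenberg p, n d * w.x + w.x * d.y = m w * d.y := by
  obtain ⟨d, hd, hc⟩ := exists_commutator he a b
  have hx : d.x = 0 := by
    have := congrArg Heisenberg.x hd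
    simp only [circ] at this
    linear_combination -this
  obtain ⟨ht, hm, hn⟩ := IsGamma.circ_add h a b
  obtain ⟨ht', hm', hn'⟩ := IsGamma.circ_add h b a
  obtain ⟨ht'', hm'', hn''⟩ := IsGamma.circ_add h d (circ t m n b a)
  rw [← hd] at ht'' hm'' hn''
  have htd : t d = 0 := by linear_combination ht - ht' - ht''
  have hmd : m d = 0 := by linear_combination hm - hm' - hm''
  rw [hmd] at hn''
  refine ⟨d, hx, htd, hmd, by linear_combination hn - hn' - hn'', ?_, ?_, fun w => ?_⟩
  · have := congrArg Heisenberg.y hd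
    rw [this]
    simp [circ, htd]
  · have := congrArg Heisenberg.z hd
    rw [this]
    simp only [circ, htd, hmd]
    ring
  · have := congrArg Heisenberg.z (hc w)
    simp only [circ, htd, hmd, hx] at this
    linear_combination this

theorem eq_famA (h3 : t ⟨0, 0, 1⟩ = 0) : ∃ t' m₁ m₂ n₁ n₂, m₂ * t' = 0 ∧ m₁ ≠ n₂ + 1 ∧
    (fun v => uni (t v) (m v) (n v)) = famA t' m₁ m₂ n₁ n₂ := by
  have h2 : (2 : ZMod p) ≠ 0 := two_ne_zero
  obtain ⟨-, hK⟩ := kernel_formulas h he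
  obtain ⟨⟨dx, dy, dz⟩, hdx, htd, hmd, hnd, hdy, -, hcd⟩ :=
    exists_circ_commutator h he ⟨1, 0, 0⟩ ⟨0, 1, 0⟩
  obtain ⟨⟨dx', dy', dz'⟩, hdx', -, -, hnd', hdy', hdz', -⟩ :=
    exists_circ_commutator h he ⟨1, 0, 0⟩ ⟨0, 0, 1⟩
  have hc1 := hcd ⟨1, 0, 0⟩
  simp only [circ] at hdx hdy hc1 hdx' hdy' hdz'
  subst hdx hdx'
  have ht2 : t ⟨0, 1, 0⟩ = 0 := by
    rw [(hK _ _).2.1, h3] at htd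
    have : t ⟨0, 1, 0⟩ * t ⟨0, 1, 0⟩ = 0 := by
      apply mul_left_cancel₀ h2
      linear_combination -htd - t ⟨0, 1, 0⟩ * hdy
    simpa using this
  have hdy0 : dy = 0 := by
    rw [ht2] at hdy
    linear_combination -hdy
  have hdy0' : dy' = 0 := by
    rw [h3] at hdy'
    linear_combination -hdy'
  subst hdy0 hdy0'
  have hmt : m ⟨0, 1, 0⟩ * t ⟨1, 0, 0⟩ = 0 := by
    apply mul_left_cancel₀ h2
    linear_combination hnd - hc1 + 2 * m ⟨1, 0, 0⟩ * ht2
  have hm3 : m ⟨0, 0, 1⟩ = 0 := by rw [(hK _ _).1, mul_zero]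
  have hn0 : n ⟨0, 0, 0⟩ = 0 := by
    have := (hK 0 1).2.2.1
    linear_combination -this
  have hn3 : n ⟨0, 0, 1⟩ = 0 := by
    rw [h3, hm3] at hnd'
    have hz : dz' = -n ⟨0, 0, 1⟩ := by
      rw [h3, hm3] at hdz'
      linear_combination -hdz' - hnd'
    rw [(hK _ _).2.2.1, hn0, hz] at hnd'
    have : n ⟨0, 0, 1⟩ * n ⟨0, 0, 1⟩ = 0 := by linear_combination -hnd'
    simpa using this
  have key : (fun v => uni (t v) (m v) (n v)) = famA (t ⟨1, 0, 0⟩) (m ⟨1, 0, 0⟩)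
      (m ⟨0, 1, 0⟩) (n ⟨1, 0, 0⟩) (n ⟨0, 1, 0⟩) := by
    refine forall_eq_of_generators h (isGamma_famA hmt) ⟨1, 0, 0⟩ ⟨0, 1, 0⟩ rfl rfl rfl ?_ ?_ ?_
    · simp [famA]
    · simp [famA, ht2]
    · simp [famA, h3, hm3, hn3]
  refine ⟨_, _, _, _, _, hmt, fun h1 => ?_, key⟩
  refine not_forall_comm he fun a b => ?_
  have hcirc : ∀ a b, circ t m n a b = a * famA (t ⟨1, 0, 0⟩) (m ⟨1, 0, 0⟩)
      (m ⟨0, 1, 0⟩) (n ⟨1, 0, 0⟩) (n ⟨0, 1, 0⟩) a b := by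
    intro a b
    rw [← key, mul_uni]
    rfl
  rw [hcirc, hcirc]
  simp only [famA, mul_uni, h1]
  ext <;> simp only <;> ring

theorem exists_values_of_ne_zero (h3 : t ⟨0, 0, 1⟩ ≠ 0) : ∃ f g,
    t ⟨1, 0, f⟩ = 0 ∧ m ⟨1, 0, f⟩ = 1 / 2 ∧ t ⟨0, 1, g⟩ = 0 ∧ m ⟨0, 1, g⟩ = 0 ∧
    n ⟨0, 1, g⟩ = -1 / 2 ∧ m ⟨0, 0, 1⟩ = 0 ∧ n ⟨0, 0, 1⟩ = 2 * g * t ⟨0, 0, 1⟩ := by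
  have h2 : (2 : ZMod p) ≠ 0 := two_ne_zero
  obtain ⟨hmt, hK⟩ := kernel_formulas h he
  have hm2 : m ⟨0, 1, 0⟩ = 0 := by simpa [h3] using hmt
  obtain ⟨f, hf⟩ : ∃ f, t ⟨1, 0, 0⟩ + t ⟨0, 0, 1⟩ * f = 0 := ⟨-t ⟨1, 0, 0⟩ / t ⟨0, 0, 1⟩, by
    field_simp; ring⟩
  obtain ⟨g, hg⟩ : ∃ g, t ⟨0, 1, 0⟩ + t ⟨0, 0, 1⟩ * g = 0 := ⟨-t ⟨0, 1, 0⟩ / t ⟨0, 0, 1⟩, by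
    field_simp; ring⟩
  have hm : ∀ y z, m ⟨0, y, z⟩ = 0 := fun y z => by rw [(hK y z).1, hm2, zero_mul]
  have hn : ∀ y z, n ⟨0, y, z⟩ = n ⟨0, 1, 0⟩ * y + n ⟨0, 0, 1⟩ * z := fun y z => by
    rw [(hK y z).2.2.1, (hK y z).2.2.2 hm2]
  have htu : t ⟨1, 0, f⟩ = 0 := by
    have := (IsGamma.circ_add h ⟨1, 0, 0⟩ ⟨0, 0, f⟩).1
    simp only [circ, mul_zero, add_zero, zero_add, zero_pow two_ne_zero] at this
    rw [this, (hK _ _).2.1]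
    linear_combination hf
  have htv : t ⟨0, 1, g⟩ = 0 := by
    rw [(hK _ _).2.1]
    linear_combination hg
  obtain ⟨⟨dx, dy, dz⟩, hdx, htd, -, hnd, hdy, hdz, hcd⟩ :=
    exists_circ_commutator h he ⟨1, 0, f⟩ ⟨0, 0, 1⟩
  have hc1 := hcd ⟨1, 0, f⟩
  simp only [circ, hm, htu] at hdx hnd hdy hdz hc1
  subst hdx
  obtain rfl : dy = -2 * t ⟨0, 0, 1⟩ := by linear_combination -hdy
  have hnd' : n ⟨0, -2 * t ⟨0, 0, 1⟩, dz⟩ = t ⟨0, 0, 1⟩ := by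
    apply mul_left_cancel₀ h2
    linear_combination hc1 + hnd
  have hmu : m ⟨1, 0, f⟩ = 1 / 2 := by
    rw [eq_div_iff h2]
    apply mul_left_cancel₀ h3
    linear_combination hnd' - hnd
  obtain rfl : dz = -n ⟨0, 0, 1⟩ := by linear_combination -hdz - hnd'
  have hn3 : n ⟨0, 0, 1⟩ = 2 * g * t ⟨0, 0, 1⟩ := by
    rw [(hK _ _).2.1] at htd
    apply mul_left_cancel₀ h3
    linear_combination -htd - 2 * t ⟨0, 0, 1⟩ * hg
  have hnv : n ⟨0, 1, g⟩ = -1 / 2 := by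
    rw [eq_div_iff h2, hn]
    rw [hn] at hnd'
    apply mul_left_cancel₀ h3
    linear_combination -hnd' - n ⟨0, 0, 1⟩ * hn3
  exact ⟨f, g, htu, hmu, htv, hm _ _, hnv, hm _ _, hn3⟩

theorem gammaRel_famB (h3 : t ⟨0, 0, 1⟩ ≠ 0) : ∃ s r, s ≠ 0 ∧
    GammaRel (famB s r) (fun v => uni (t v) (m v) (n v)) := by
  have h2 : (2 : ZMod p) ≠ 0 := two_ne_zero
  obtain ⟨f, g, htu, hmu, htv, hmv, hnv, hmw, hnw⟩ := exists_values_of_ne_zero h he h3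
  obtain ⟨s, hs⟩ : ∃ s, s * 2 = t ⟨0, 0, 1⟩ := ⟨t ⟨0, 0, 1⟩ / 2, div_mul_cancel₀ _ h2⟩
  refine ⟨s, n ⟨1, 0, f⟩, fun h0 => h3 (by rw [← hs, h0, zero_mul]), ?_⟩
  have hdet : (1 * 1 - 0 * 0 : ZMod p) ≠ 0 := by simp
  have key : (fun v => uni (t v) (m v) (n v)) =
      conjGamma (mkAut 1 0 0 1 f g hdet) (famB s (n ⟨1, 0, f⟩)) := by
    have hconj : ∀ v w, mkAut 1 0 0 1 f g hdet v = w →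
        uni (t w) (m w) (n w) * mkAut 1 0 0 1 f g hdet =
          mkAut 1 0 0 1 f g hdet * famB s (n ⟨1, 0, f⟩) v →
        uni (t w) (m w) (n w) = conjGamma (mkAut 1 0 0 1 f g hdet) (famB s (n ⟨1, 0, f⟩)) w := by
      rintro v w rfl hv
      rw [conjGamma, MulAut.inv_apply_self, ← hv, mul_inv_cancel_right]
    refine forall_eq_of_generators h ((isGamma_famB _ _).conjGamma _) ⟨1, 0, f⟩ ⟨0, 1, g⟩
      rfl rfl rfl (hconj ⟨1, 0, 0⟩ _ ?_ ?_) (hconj ⟨0, 1, 0⟩ _ ?_ ?_) (hconj ⟨0, 0, 1⟩ _ ?_ ?_)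
    · ext <;> simp
    · rw [famB, uni_mul_mkAut_iff, htu, hmu]
      simp
    · ext <;> simp
    · rw [famB, uni_mul_mkAut_iff, htv, hnv, hmv]
      simp
    · ext <;> simp
    · rw [famB, uni_mul_mkAut_iff, hnw, hmw]
      simp [hs]
  rw [key]
  exact gammaRel_conjGamma _ _

end Classification

theorem exists_gammaRel_fam {lam : Heisenberg p → MulAut (Heisenberg p)} (h : IsGamma lam)
    (hH : IsHeisenbergGamma lam) :
    (∃ t m₁ m₂ n₁ n₂, m₂ * t = 0 ∧ m₁ ≠ n₂ + 1 ∧ GammaRel (famA t m₁ m₂ n₁ n₂) lam) ∨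
      ∃ s r, s ≠ 0 ∧ GammaRel (famB s r) lam := by
  obtain ⟨α, t, m, n, hα⟩ := exists_gammaRel_uni h
  have hrel := (gammaRel_conjGamma α lam).symm
  have h' := h.conjGamma α
  obtain ⟨e, he⟩ := hH.conjGamma α
  rw [hα] at h' hrel
  have he : ∀ a b, e (circ t m n a b) = e a * e b := by
    intro a b
    rw [← he, hα, mul_uni]
    rfl
  by_cases h3 : t ⟨0, 0, 1⟩ = 0
  · obtain ⟨t', m₁, m₂, n₁, n₂, h0, h1, heq⟩ := eq_famA h' he h3
    rw [heq] at hrel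
    exact Or.inl ⟨_, _, _, _, _, h0, h1, hrel⟩
  · obtain ⟨s, r, hs, hr⟩ := gammaRel_famB h' he h3
    exact Or.inr ⟨s, r, hs, hr.trans hrel⟩

end Heisenberg

namespace Heisenberg

variable {p : ℕ}

theorem autConj_one (G : Subgroup (Equiv.Perm (Heisenberg p))) : autConj p 1 G = G := by
  rw [autConj, map_one, map_one]
  exact G.map_id

theorem autConj_mul (α β : MulAut (Heisenberg p)) (G : Subgroup (Equiv.Perm (Heisenberg p))) :
    autConj p (α * β) G = autConj p α (autConj p β G) := by
  simp only [autConj, map_mul, Subgroup.map_map]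
  rfl

theorem equivalence_autConj (P : Subgroup (Equiv.Perm (Heisenberg p)) → Prop) :
    Equivalence fun G G' : {G // P G} => ∃ α : MulAut (Heisenberg p), autConj p α G.1 = G'.1 where
  refl G := ⟨1, autConj_one _⟩
  symm := by
    rintro G G' ⟨α, h⟩
    exact ⟨α⁻¹, by rw [← h, ← autConj_mul, inv_mul_cancel, autConj_one]⟩
  trans := by
    rintro G G' G'' ⟨α, h⟩ ⟨β, h'⟩
    exact ⟨β * α, by rw [autConj_mul, h, h']⟩

variable [Fact p.Prime]

theorem exists_eq_mul_sq_of_not_isSquare {ν : ZMod p} (hν : ¬ IsSquare ν) {s : ZMod p}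
    (hs : s ≠ 0) : ∃ b : Bool, ∃ a, a ≠ 0 ∧ s = (if b then 1 else ν) * a ^ 2 := by
  by_cases h : IsSquare s
  · obtain ⟨a, rfl⟩ := h
    exact ⟨true, a, by simpa using hs, by simp [sq]⟩
  · have hν0 : ν ≠ 0 := fun h0 => hν (h0 ▸ IsSquare.zero)
    have : IsSquare (ν * s) := by
      rw [← quadraticChar_one_iff_isSquare (mul_ne_zero hν0 hs), map_mul,
        quadraticChar_neg_one_iff_not_isSquare.mpr hν,
        quadraticChar_neg_one_iff_not_isSquare.mpr h]
      rfl
    obtain ⟨x, hx⟩ := this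
    have hx0 : x ≠ 0 := fun h0 => mul_ne_zero hν0 hs (by rw [hx, h0, mul_zero])
    refine ⟨false, x / ν, div_ne_zero hx0 hν0, ?_⟩
    simp only [Bool.false_eq_true, if_false]
    field_simp
    linear_combination hx

variable [Fact (3 < p)]

theorem gammaRel_companion {a c m₁ m₂ n₁ n₂ : ZMod p}
    (h : n₁ * a ^ 2 + (n₂ + m₁) * a * c + m₂ * c ^ 2 ≠ 0) :
    GammaRel (famA 0 0 (-(m₂ * n₁ - m₁ * n₂)) (-1) (-(m₁ - n₂))) (famA 0 m₁ m₂ n₁ n₂) := by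
  have hdet : a * (-n₁ * a - n₂ * c) - (m₁ * a + m₂ * c) * c ≠ 0 := by
    contrapose! h
    linear_combination -h
  refine ⟨mkAut a (m₁ * a + m₂ * c) c (-n₁ * a - n₂ * c) 0 0 hdet, fun v => ?_⟩
  rw [famA, famA, uni_mul_mkAut_iff]
  simp only [mkAut_apply, endHom_x, endHom_y]
  refine ⟨?_, ?_, ?_, ?_, ?_⟩ <;> ring

theorem exists_gammaRel_companion {m₁ m₂ n₁ n₂ : ZMod p}
    (h : ¬ (m₂ = 0 ∧ n₁ = 0 ∧ m₁ + n₂ = 0)) :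
    GammaRel (famA 0 0 (-(m₂ * n₁ - m₁ * n₂)) (-1) (-(m₁ - n₂))) (famA 0 m₁ m₂ n₁ n₂) := by
  by_cases hn : n₁ = 0
  · by_cases hm : m₂ = 0
    · refine gammaRel_companion (a := 1) (c := 1) fun h0 => h ⟨hm, hn, ?_⟩
      linear_combination h0 - hn - hm
    · exact gammaRel_companion (a := 0) (c := 1) (by simpa using hm)
  · exact gammaRel_companion (a := 1) (c := 0) (by simpa using hn)

theorem gammaRel_famA_one {t m₁ n₁ n₂ : ZMod p} (ht : t ≠ 0) :
    GammaRel (famA t m₁ 0 n₁ n₂) (famA 1 m₁ 0 0 n₂) := by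
  have h2 : (2 : ZMod p) ≠ 0 := two_ne_zero
  refine ⟨mkAut 1 0 0 (1 / t) 0 (-n₁ / (2 * t ^ 2)) (by simpa using ht), fun v => ?_⟩
  rw [famA, famA, uni_mul_mkAut_iff]
  simp only [mkAut_apply, endHom_x, endHom_y]
  refine ⟨?_, ?_, ?_, ?_, ?_⟩ <;> field_simp <;> ring

theorem gammaRel_famB_of_eq {s r s' r' a d : ZMod p} (ha : a ≠ 0) (hd : d ≠ 0)
    (hs : s = s' * a ^ 2) (hr : r' * a = d * r) : GammaRel (famB s r) (famB s' r') := by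
  have h2 : (2 : ZMod p) ≠ 0 := two_ne_zero
  subst hs
  refine ⟨mkAut a 0 0 d ((r' * a ^ 2 - r' * a) / 2) 0 (by simp [ha, hd]), fun v => ?_⟩
  rw [famB, famB, uni_mul_mkAut_iff]
  simp only [mkAut_apply, endHom_x, endHom_y, endHom_z]
  refine ⟨?_, ?_, ?_, ?_, ?_⟩
  · ring
  · ring
  · field_simp
    linear_combination s' * a * v.x * (v.x - 1) * hr
  · ring
  · field_simp
    linear_combination (2 * a ^ 3 * v.x ^ 2 * s' * (v.x - 1) - 2 * a * v.x) * hr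

theorem GammaRel.invariants {m₁ m₂ n₁ n₂ m₁' m₂' n₁' n₂' : ZMod p}
    (h : GammaRel (famA 0 m₁ m₂ n₁ n₂) (famA 0 m₁' m₂' n₁' n₂')) :
    m₁ - n₂ = m₁' - n₂' ∧ m₂ * n₁ - m₁ * n₂ = m₂' * n₁' - m₁' * n₂' ∧
      (m₂' = 0 → n₁' = 0 → m₁' + n₂' = 0 → n₁ = 0) := by
  obtain ⟨α, hα⟩ := h
  obtain ⟨a, b, c, d, f, g, hdet, rfl⟩ := exists_eq_mkAut α
  obtain ⟨-, -, -, e1, e2⟩ := (uni_mul_mkAut_iff ..).mp (hα ⟨1, 0, 0⟩)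
  obtain ⟨-, -, -, e3, e4⟩ := (uni_mul_mkAut_iff ..).mp (hα ⟨0, 1, 0⟩)
  simp only [mkAut_apply, endHom_x, endHom_y] at e1 e2 e3 e4
  refine ⟨?_, ?_, fun hm hn hmn => ?_⟩
  · apply mul_left_cancel₀ hdet
    linear_combination e1 - e4
  · apply mul_left_cancel₀ (mul_ne_zero hdet hdet)
    linear_combination (a * d - b * c) * n₁ * e3 - (a * d - b * c) * n₂ * e1 +
      ((n₁' * b + n₂' * d) * b + (m₁' * b + m₂' * d) * d) * e2 -
      ((n₁' * a + n₂' * c) * b + (m₁' * a + m₂' * c) * d) * e4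
  · apply mul_left_cancel₀ hdet
    rw [hm, hn] at e2
    linear_combination e2 + a * c * hmn

theorem not_gammaRel_famA_zero_one {m₁ m₂ n₁ n₂ m₁' m₂' n₁' n₂' : ZMod p} :
    ¬ GammaRel (famA 0 m₁ m₂ n₁ n₂) (famA 1 m₁' m₂' n₁' n₂') := by
  rintro ⟨α, hα⟩
  obtain ⟨a, b, c, d, f, g, hdet, rfl⟩ := exists_eq_mkAut α
  obtain ⟨-, -, e1, -⟩ := (uni_mul_mkAut_iff ..).mp (hα ⟨1, 0, 0⟩)
  obtain ⟨-, e2, -⟩ := (uni_mul_mkAut_iff ..).mp (hα ⟨0, 1, 0⟩)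
  have ha : a = 0 := by simpa using e1
  have hb : b = 0 := by simpa using e2
  simp [ha, hb] at hdet

theorem GammaRel.eq_of_famA_one {m₁ n₂ m₁' n₂' : ZMod p}
    (h : GammaRel (famA 1 m₁ 0 0 n₂) (famA 1 m₁' 0 0 n₂')) : m₁ = m₁' ∧ n₂ = n₂' := by
  obtain ⟨α, hα⟩ := h
  obtain ⟨a, b, c, d, f, g, hdet, rfl⟩ := exists_eq_mkAut α
  obtain ⟨h1, -, h3, h4, -⟩ := (uni_mul_mkAut_iff ..).mp (hα ⟨1, 0, 0⟩)
  obtain ⟨-, -, -, -, h5⟩ := (uni_mul_mkAut_iff ..).mp (hα ⟨0, 1, 0⟩)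
  simp only [mkAut_apply, endHom_x, endHom_y] at h1 h3 h4 h5
  obtain rfl : b = 0 := by linear_combination h1
  exact ⟨mul_left_cancel₀ hdet (by linear_combination h4),
    mul_left_cancel₀ hdet (by linear_combination h5)⟩

theorem not_gammaRel_famA_famB {t m₁ m₂ n₁ n₂ s r : ZMod p} (hs : s ≠ 0) :
    ¬ GammaRel (famA t m₁ m₂ n₁ n₂) (famB s r) := by
  have h2 : (2 : ZMod p) ≠ 0 := two_ne_zero
  rintro ⟨α, hα⟩
  obtain ⟨a, b, c, d, f, g, hdet, rfl⟩ := exists_eq_mkAut α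
  obtain ⟨-, e1, e2, -⟩ := (uni_mul_mkAut_iff ..).mp (hα ⟨0, 0, 1⟩)
  have ha : a = 0 := by simpa [hs, h2, hdet] using e2
  have hb : b = 0 := by simpa [hs, h2, hdet] using e1
  simp [ha, hb] at hdet

theorem GammaRel.exists_of_famB {s r s' r' : ZMod p} (hs : s ≠ 0)
    (h : GammaRel (famB s r) (famB s' r')) :
    ∃ a d, a ≠ 0 ∧ d ≠ 0 ∧ s = s' * a ^ 2 ∧ d * r = r' * a := by
  have h2 : (2 : ZMod p) ≠ 0 := two_ne_zero
  obtain ⟨α, hα⟩ := h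
  obtain ⟨a, b, c, d, f, g, hdet, rfl⟩ := exists_eq_mkAut α
  obtain ⟨h1, -, h3, -, h5⟩ := (uni_mul_mkAut_iff ..).mp (hα ⟨0, 0, 1⟩)
  have hb : b = 0 := by simpa [hs, h2] using h1
  subst hb
  have had : a ≠ 0 ∧ d ≠ 0 := by simpa using hdet
  obtain ⟨-, -, e3, -, e5⟩ := (uni_mul_mkAut_iff ..).mp (hα ⟨1, 0, 0⟩)
  simp only [mkAut_apply, endHom_x, endHom_y, endHom_z] at h3 h5 e3 e5
  refine ⟨a, d, had.1, had.2, ?_, ?_⟩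
  · apply mul_left_cancel₀ (mul_ne_zero h2 had.2)
    linear_combination h3
  · apply mul_left_cancel₀ had.1
    linear_combination e5 - a * e3

end Heisenberg

namespace Heisenberg

variable {p : ℕ}

/-- Index type for the normal forms of `λ`-maps. -/
abbrev NormalForm (p : ℕ) : Type :=
  {T : ZMod p // T ≠ 1} ⊕ ({T : ZMod p // T ≠ 1} × ZMod p) ⊕ ({T : ZMod p // T ≠ 1} × ZMod p) ⊕
    (Bool × Bool)

variable [Fact p.Prime]

theorem natCard_normalForm : Nat.card (NormalForm p) = 2 * p ^ 2 - p + 3 := by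
  have hT : Nat.card {T : ZMod p // T ≠ 1} = p - 1 := by
    rw [Nat.card_eq_fintype_card, Fintype.card_subtype_compl, ZMod.card, Fintype.card_subtype_eq]
  have hZ : Nat.card (ZMod p) = p := by rw [Nat.card_eq_fintype_card, ZMod.card]
  have hB : Nat.card Bool = 2 := by simp
  rw [Nat.card_sum, Nat.card_sum, Nat.card_sum, Nat.card_prod, Nat.card_prod, hT, hZ, hB]
  obtain ⟨k, rfl⟩ : ∃ k, p = k + 1 := ⟨p - 1, (Nat.succ_pred_prime Fact.out).symm⟩
  have : 2 * (k + 1) ^ 2 = (k + (k * (k + 1) + k * (k + 1)) + 1) + (k + 1) := by ring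
  rw [this, Nat.add_sub_cancel, Nat.add_sub_cancel]
  ring

/-- Representatives of the isomorphism classes of skew braces, where `ν` is a nonsquare. -/
def normalForm (ν : ZMod p) : NormalForm p → Heisenberg p → MulAut (Heisenberg p)
  | .inl T => famA 0 (T / 2) 0 0 (-T / 2)
  | .inr (.inl (T, D)) => famA 0 0 (-D) (-1) (-T)
  | .inr (.inr (.inl (T, n))) => famA 1 (n + T) 0 0 n
  | .inr (.inr (.inr (b, b'))) => famB (if b then 1 else ν) (if b' then 1 else 0)

variable {ν : ZMod p} (hν : ¬ IsSquare ν)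

theorem isGamma_normalForm [Fact (3 < p)] (ν : ZMod p) (i : NormalForm p) :
    IsGamma (normalForm ν i) := by
  obtain T | ⟨T, D⟩ | ⟨T, n⟩ | ⟨b, b'⟩ := i
  · exact isGamma_famA (by simp)
  · exact isGamma_famA (by simp)
  · exact isGamma_famA (by simp)
  · exact isGamma_famB _ _

include hν

theorem ite_one_nonsquare_ne_zero (b : Bool) : (if b then 1 else ν) ≠ 0 := by
  have : ν ≠ 0 := fun h0 => hν (h0 ▸ IsSquare.zero)
  cases b <;> simp [this]

variable [Fact (3 < p)]

theorem isHeisenbergGamma_normalForm (i : NormalForm p) :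
    IsHeisenbergGamma (normalForm ν i) := by
  have h2 : (2 : ZMod p) ≠ 0 := two_ne_zero
  obtain T | ⟨T, D⟩ | ⟨T, n⟩ | ⟨b, b'⟩ := i
  · refine isHeisenbergGamma_famA (by simp) fun h => T.2 ?_
    field_simp at h
    apply mul_left_cancel₀ h2
    linear_combination h
  · exact isHeisenbergGamma_famA (by simp) fun h => T.2 (by linear_combination h)
  · exact isHeisenbergGamma_famA (by simp) fun h => T.2 (by linear_combination h)
  · exact isHeisenbergGamma_famB (ite_one_nonsquare_ne_zero hν b) _

theorem exists_gammaRel_normalForm {lam : Heisenberg p → MulAut (Heisenberg p)} (h : IsGamma lam)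
    (hH : IsHeisenbergGamma lam) : ∃ i, GammaRel (normalForm ν i) lam := by
  have h2 : (2 : ZMod p) ≠ 0 := two_ne_zero
  obtain ⟨t, m₁, m₂, n₁, n₂, h0, h1, hrel⟩ | ⟨s, r, hs, hrel⟩ := exists_gammaRel_fam h hH
  · have hT : m₁ - n₂ ≠ 1 := fun hT => h1 (by linear_combination hT)
    by_cases ht : t = 0
    · subst ht
      by_cases hscal : m₂ = 0 ∧ n₁ = 0 ∧ m₁ + n₂ = 0
      · obtain ⟨rfl, rfl, hmn⟩ := hscal
        refine ⟨.inl ⟨m₁ - n₂, hT⟩, ?_⟩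
        have hm : (m₁ - n₂) / 2 = m₁ := by
          field_simp
          linear_combination -hmn
        have hn : -(m₁ - n₂) / 2 = n₂ := by
          field_simp
          linear_combination -hmn
        rw [normalForm, hm, hn]
        exact hrel
      · exact ⟨.inr (.inl (⟨m₁ - n₂, hT⟩, m₂ * n₁ - m₁ * n₂)),
          (exists_gammaRel_companion hscal).trans hrel⟩
    · obtain rfl : m₂ = 0 := by simpa [ht] using h0
      refine ⟨.inr (.inr (.inl (⟨m₁ - n₂, hT⟩, n₂))), ?_⟩
      rw [normalForm, add_sub_cancel]
      exact (gammaRel_famA_one ht).symm.trans hrel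
  · obtain ⟨b, a, ha, hb⟩ := exists_eq_mul_sq_of_not_isSquare hν hs
    by_cases hr : r = 0
    · refine ⟨.inr (.inr (.inr (b, false))), GammaRel.trans (GammaRel.symm ?_) hrel⟩
      exact gammaRel_famB_of_eq ha one_ne_zero hb (by simp [hr])
    · refine ⟨.inr (.inr (.inr (b, true))), GammaRel.trans (GammaRel.symm ?_) hrel⟩
      exact gammaRel_famB_of_eq ha (div_ne_zero ha hr) hb (by simp [hr])

theorem eq_of_gammaRel_famB {b b' c c' : Bool}
    (h : GammaRel (famB (if b then 1 else ν) (if b' then 1 else 0))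
      (famB (if c then 1 else ν) (if c' then 1 else 0))) : b = c ∧ b' = c' := by
  obtain ⟨a, d, ha, hd, hs, hr⟩ := h.exists_of_famB (ite_one_nonsquare_ne_zero hν b)
  constructor
  · cases b <;> cases c <;> simp only [Bool.false_eq_true, if_true, if_false] at hs
    · rfl
    · exact absurd ⟨a, by linear_combination hs⟩ hν
    · exact absurd ⟨1 / a, by field_simp; linear_combination -hs⟩ hν
    · rfl
  · cases b' <;> cases c' <;> simp [ha.symm, hd] at hr ⊢

theorem normalForm_injective {i j : NormalForm p}
    (h : GammaRel (normalForm ν i) (normalForm ν j)) : i = j := by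
  have h2 : (2 : ZMod p) ≠ 0 := two_ne_zero
  have hB := ite_one_nonsquare_ne_zero hν
  have hT : ∀ {T T' : ZMod p}, T / 2 - -T / 2 = T' / 2 - -T' / 2 → T = T' := by
    intro T T' h
    field_simp at h
    apply mul_left_cancel₀ h2
    linear_combination h
  obtain ⟨T, hT1⟩ | ⟨⟨T, hT1⟩, D⟩ | ⟨⟨T, hT1⟩, n⟩ | ⟨b, b'⟩ := i <;>
    obtain ⟨T', hT1'⟩ | ⟨⟨T', hT1'⟩, D'⟩ | ⟨⟨T', hT1'⟩, n'⟩ | ⟨c, c'⟩ := j <;>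
    simp only [normalForm] at h
  · obtain rfl := hT h.invariants.1
    rfl
  · have := h.symm.invariants.2.2 rfl rfl (by ring)
    simp at this
  · exact absurd h not_gammaRel_famA_zero_one
  · exact absurd h (not_gammaRel_famA_famB (hB _))
  · have := h.invariants.2.2 rfl rfl (by ring)
    simp at this
  · obtain ⟨e1, e2, -⟩ := h.invariants
    obtain rfl : T = T' := by linear_combination e1
    obtain rfl : D = D' := by linear_combination e2
    rfl
  · exact absurd h not_gammaRel_famA_zero_one
  · exact absurd h (not_gammaRel_famA_famB (hB _))
  · exact absurd h.symm not_gammaRel_famA_zero_one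
  · exact absurd h.symm not_gammaRel_famA_zero_one
  · obtain ⟨e1, rfl⟩ := h.eq_of_famA_one
    obtain rfl := add_left_cancel e1
    rfl
  · exact absurd h (not_gammaRel_famA_famB (hB _))
  · exact absurd h.symm (not_gammaRel_famA_famB (hB _))
  · exact absurd h.symm (not_gammaRel_famA_famB (hB _))
  · exact absurd h.symm (not_gammaRel_famA_famB (hB _))
  · obtain ⟨rfl, rfl⟩ := eq_of_gammaRel_famB hν h
    rfl

end Heisenberg

/-- Up to the conjugation action of `Aut(M₁)`, there are exactly
`2p² − p + 3` regular subgroups of `Hol(M₁)` isomorphic to `M₁`; equivalently, there are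
exactly `2p² − p + 3` skew braces with multiplicative and additive group `M₁`. -/
theorem skew_brace_count_M1_M1 (p : ℕ) [Fact p.Prime] (h3 : 3 < p) :
    Nat.card (Quot (fun (G G' : {G : Subgroup (Equiv.Perm (Heisenberg p)) //
        G ≤ Hol p ∧ IsRegularSub G ∧ Nonempty (G ≃* Heisenberg p)}) =>
      ∃ α : MulAut (Heisenberg p), autConj p α G.1 = G'.1)) = 2 * p ^ 2 - p + 3 := by
  have : Fact (3 < p) := ⟨h3⟩
  obtain ⟨ν, hν⟩ := FiniteField.exists_nonsquare (F := ZMod p) (by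
    rw [ZMod.ringChar_zmod_n]
    omega)
  let rep (i : NormalForm p) : {G : Subgroup (Equiv.Perm (Heisenberg p)) //
      G ≤ Hol p ∧ IsRegularSub G ∧ Nonempty (G ≃* Heisenberg p)} :=
    ⟨gammaSub _ (isGamma_normalForm ν i), gammaSub_le_Hol _, isRegularSub_gammaSub _,
      (nonempty_gammaSub_mulEquiv_iff _ _).mpr (isHeisenbergGamma_normalForm hν i)⟩
  rw [← natCard_normalForm]
  refine (Nat.card_eq_of_bijective (fun i => Quot.mk _ (rep i)) ⟨fun i j hij => ?_, ?_⟩).symm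
  · obtain ⟨α, hα⟩ := (equivalence_autConj _).eqvGen_iff.mp (Quot.eqvGen_exact hij)
    exact normalForm_injective hν ⟨α,
      (map_conj_gammaSub (isGamma_normalForm ν i) (isGamma_normalForm ν j) α).mp hα⟩
  · rintro ⟨G, hG, hr, hiso⟩
    obtain ⟨lam, h, rfl⟩ := exists_gammaSub_eq hG hr
    obtain ⟨i, α, hα⟩ :=
      exists_gammaRel_normalForm hν h ((nonempty_gammaSub_mulEquiv_iff _ _).mp hiso)
    exact ⟨i, Quot.sound ⟨α, (map_conj_gammaSub (isGamma_normalForm ν i) h α).mpr hα⟩⟩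
end

section
/- Let p > 3 be prime. Every regular subgroup of Hol(M₁) is isomorphic either to M₁ or to the elementary abelian group (ZMod p)³; in particular, no regular subgroup of Hol(M₁) is isomorphic to C_{p³}, to C_{p²} × C_p, or to the extraspecial group C_{p²} ⋊ C_p of exponent p². -/
open Heisenberg

/-- The extraspecial group `C_{p²} ⋊ C_p` of order `p³` and exponent `p²`, given by its
presentation `⟨σ, τ ∣ σ^{p²} = τ^p = 1, τστ⁻¹ = σ^{p+1}⟩`. -/
abbrev ExtraspecialPresented (p : ℕ) : Type :=
  PresentedGroup ({FreeGroup.of 0 ^ p ^ 2, FreeGroup.of 1 ^ p,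
    FreeGroup.of 1 * FreeGroup.of 0 * (FreeGroup.of 1)⁻¹ * (FreeGroup.of 0 ^ (p + 1))⁻¹} :
      Set (FreeGroup (Fin 2)))

/-! ## Finite groups of order `p³` and exponent `p` -/

/-- A unipotent operator of `p`-power order on a space of dimension at most `p` over `𝔽_p` has
order dividing `p`. -/
theorem Module.End.pow_prime_eq_one_of_pow_prime_pow_eq_one {p : ℕ} [Fact p.Prime] {V : Type*}
    [AddCommGroup V] [Module (ZMod p) V] [Module.Finite (ZMod p) V]
    (hV : Module.finrank (ZMod p) V ≤ p) (T : Module.End (ZMod p) V) {k : ℕ}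
    (hT : T ^ p ^ k = 1) : T ^ p = 1 := by
  have key (m : ℕ) : (T - 1) ^ p ^ m = T ^ p ^ m - 1 := by
    have h := congrArg (Polynomial.aeval T)
      (sub_pow_char_pow (Polynomial.X : Polynomial (ZMod p)) 1 (p := p) m)
    simpa using h
  have hnil : IsNilpotent (T - 1) := ⟨p ^ k, by rw [key, hT, sub_self]⟩
  have h0 := LinearMap.aeval_self_charpoly (T - 1)
  rw [(LinearMap.isNilpotent_iff_charpoly _).1 hnil, map_pow, Polynomial.aeval_X] at h0
  have h1 := key 1
  rw [pow_one, pow_eq_zero_of_le hV h0] at h1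
  exact sub_eq_zero.1 h1.symm

theorem Heisenberg.natCard {p : ℕ} : Nat.card (Heisenberg p) = p ^ 3 := by
  let e : Heisenberg p ≃ ZMod p × ZMod p × ZMod p :=
    { toFun := fun g => (g.x, g.y, g.z)
      invFun := fun t => ⟨t.1, t.2.1, t.2.2⟩
      left_inv := fun _ => rfl
      right_inv := fun _ => rfl }
  rw [Nat.card_congr e, Nat.card_prod, Nat.card_prod, Nat.card_zmod]
  ring

section ExponentPrime

open scoped commutatorElement

variable {p : ℕ} [Fact p.Prime] {G : Type*} [Group G]

theorem nonempty_mulEquiv_of_comm_of_pow_prime_eq_one (hcard : Nat.card G = p ^ 3)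
    (hexp : ∀ g : G, g ^ p = 1) (hcomm : ∀ a b : G, a * b = b * a) :
    Nonempty (G ≃* Multiplicative (ZMod p × ZMod p × ZMod p)) := by
  have hp : p.Prime := Fact.out
  let : CommGroup G := { (inferInstance : Group G) with mul_comm := hcomm }
  let : Module (ZMod p) (Additive G) :=
    AddCommGroup.zmodModule (n := p) fun x => hexp x.toMul
  have : Finite G := Nat.finite_of_card_ne_zero (by rw [hcard]; exact (pow_pos hp.pos 3).ne')
  have : Finite (Additive G) := ‹Finite G›
  have h : Module.finrank (ZMod p) (Additive G) = 3 := by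
    have h := Module.natCard_eq_pow_finrank (K := ZMod p) (V := Additive G)
    rw [Nat.card_zmod, show Nat.card (Additive G) = p ^ 3 from hcard] at h
    exact (Nat.pow_right_injective hp.two_le h).symm
  let e : Additive G ≃ₗ[ZMod p] ZMod p × ZMod p × ZMod p :=
    LinearEquiv.ofFinrankEq _ _ (by simp [h])
  exact ⟨e.toAddEquiv.toMultiplicativeRight⟩

/-- In a group of order `p³` all commutators are central. -/
theorem commutatorElement_mem_center_of_card_eq_prime_pow_three (hcard : Nat.card G = p ^ 3)
    (a b : G) : ⁅a, b⁆ ∈ Subgroup.center G := by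
  have hp : p.Prime := Fact.out
  have : Finite G := Nat.finite_of_card_ne_zero (by rw [hcard]; exact (pow_pos hp.pos 3).ne')
  have hG : IsPGroup p G := IsPGroup.of_card hcard
  have : Nontrivial G := (hG.nontrivial_iff_card).2 ⟨3, by norm_num, hcard⟩
  have := hG.center_nontrivial
  obtain ⟨m, hm, hmc⟩ := ((hG.to_subgroup (Subgroup.center G)).nontrivial_iff_card).1 this
  obtain ⟨k, hk⟩ := IsPGroup.iff_card.1 (hG.to_quotient (Subgroup.center G))
  have hmul := Subgroup.card_eq_card_quotient_mul_card_subgroup (Subgroup.center G)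
  rw [hcard, hk, hmc, ← pow_add] at hmul
  have hkm := Nat.pow_right_injective hp.two_le hmul
  have hcomm : ∀ u v : G ⧸ Subgroup.center G, u * v = v * u := by
    rcases Nat.lt_or_ge k 2 with h | h
    · have : IsCyclic (G ⧸ Subgroup.center G) := isCyclic_of_card_dvd_prime (p := p) (by
        rw [hk]; exact (pow_dvd_pow p (Nat.lt_succ_iff.1 h)).trans (pow_one p).dvd)
      exact fun u v => (IsCyclic.isMulCommutative (α := G ⧸ Subgroup.center G)).is_comm.comm u v
    · obtain rfl : k = 2 := by
        have : 3 = k + m := hkm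
        omega
      exact fun u v => (IsPGroup.isMulCommutative_of_card_eq_prime_sq hk).is_comm.comm u v
  rw [← QuotientGroup.eq_one_iff, ← QuotientGroup.mk'_apply, map_commutatorElement,
    commutatorElement_eq_one_iff_mul_comm]
  exact hcomm _ _

theorem pow_zmod_val_add {a : G} (ha : a ^ p = 1) (s t : ZMod p) :
    a ^ (s + t).val = a ^ s.val * a ^ t.val := by
  rw [ZMod.val_add, ← pow_add, ← pow_eq_pow_mod _ ha]

theorem pow_zmod_val_mul {a : G} (ha : a ^ p = 1) (s t : ZMod p) :
    a ^ (s * t).val = a ^ (s.val * t.val) := by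
  rw [ZMod.val_mul, ← pow_eq_pow_mod _ ha]

theorem zmod_eq_zero_of_pow_val_eq_one {a : G} (ha : a ^ p = 1) (ha1 : a ≠ 1) {s : ZMod p}
    (h : a ^ s.val = 1) : s = 0 := by
  rw [← orderOf_dvd_iff_pow_eq_one, orderOf_eq_prime ha ha1] at h
  rw [← ZMod.val_eq_zero]
  exact Nat.eq_zero_of_dvd_of_lt h (ZMod.val_lt s)

theorem pow_mul_pow_of_mul_eq {a b c : G} (hca : Commute c a) (hcb : Commute c b)
    (h : b * a = c * (a * b)) (m n : ℕ) : b ^ m * a ^ n = c ^ (m * n) * (a ^ n * b ^ m) := by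
  have h1 (n : ℕ) : b * a ^ n = c ^ n * (a ^ n * b) := by
    induction n with
    | zero => simp
    | succ n ih =>
      rw [pow_succ a, ← mul_assoc, ih, mul_assoc, mul_assoc, h, pow_succ c]
      have := (hca.pow_right n).eq
      simp only [mul_assoc]
      rw [← mul_assoc (a ^ n) c, ← this]
      simp only [mul_assoc]
  induction m with
  | zero => simp
  | succ m ih =>
    rw [pow_succ' b, mul_assoc, ih, ← mul_assoc b, ← (hcb.pow_left _).eq, mul_assoc,
      ← mul_assoc b, h1]
    simp only [← mul_assoc, ← pow_add]
    rw [Nat.succ_mul]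

theorem nonempty_mulEquiv_heisenberg_of_pow_prime_eq_one (hcard : Nat.card G = p ^ 3)
    (hexp : ∀ g : G, g ^ p = 1) (hcomm : ¬ ∀ a b : G, a * b = b * a) :
    Nonempty (G ≃* Heisenberg p) := by
  have hp : p.Prime := Fact.out
  push Not at hcomm
  obtain ⟨b, a, hab⟩ := hcomm
  set c := ⁅b, a⁆ with hc
  have hcz : c ∈ Subgroup.center G :=
    commutatorElement_mem_center_of_card_eq_prime_pow_three hcard b a
  have hcc (g : G) : Commute c g := (Subgroup.mem_center_iff.1 hcz g).symm
  have hc1 : c ≠ 1 := by rwa [hc, Ne, commutatorElement_eq_one_iff_mul_comm]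
  have hba : b * a = c * (a * b) := by rw [hc, commutatorElement_def]; group
  have hpow := pow_mul_pow_of_mul_eq (hcc a) (hcc b) hba
  let f : Heisenberg p →* G := MonoidHom.mk'
    (fun g => c ^ g.z.val * (a ^ g.x.val * b ^ g.y.val)) (fun g h => by
      simp only [mul_x, mul_y, mul_z]
      rw [pow_zmod_val_add (hexp c), pow_zmod_val_add (hexp c), pow_zmod_val_add (hexp a),
        pow_zmod_val_add (hexp b), pow_zmod_val_mul (hexp c), mul_comm h.x.val]
      have h1 := ((hcc (a ^ g.x.val * b ^ g.y.val)).pow_left h.z.val).eq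
      have h2 := ((hcc (a ^ g.x.val)).pow_left (g.y.val * h.x.val)).eq
      calc _ = c ^ g.z.val * c ^ h.z.val * ((c ^ (g.y.val * h.x.val) * a ^ g.x.val)
              * (a ^ h.x.val * b ^ g.y.val) * b ^ h.y.val) := by simp only [mul_assoc]
        _ = c ^ g.z.val * c ^ h.z.val * (a ^ g.x.val
              * (c ^ (g.y.val * h.x.val) * (a ^ h.x.val * b ^ g.y.val)) * b ^ h.y.val) := by
            rw [h2]; simp only [mul_assoc]
        _ = c ^ g.z.val * (c ^ h.z.val * (a ^ g.x.val * b ^ g.y.val))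
              * (a ^ h.x.val * b ^ h.y.val) := by
            rw [← hpow]; simp only [mul_assoc]
        _ = _ := by rw [h1]; simp only [mul_assoc])
  have hf (g : Heisenberg p) : f g = c ^ g.z.val * (a ^ g.x.val * b ^ g.y.val) := rfl
  have hker {t : ZMod p} (ht : f ⟨0, 0, t⟩ = 1) : t = 0 :=
    zmod_eq_zero_of_pow_val_eq_one (hexp c) hc1 (by simpa [hf] using ht)
  have hinj : Function.Injective f := by
    rw [injective_iff_map_eq_one]
    intro g hg
    have hx : g.x = 0 := hker <| by
      have h : f (⟨0, 0, g.x⟩ * (g * τ)) = f (τ * g) := congrArg f (by ext <;> simp [τ, add_comm])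
      simpa [hg] using h
    have hy : g.y = 0 := hker <| by
      have h : f (⟨0, 0, g.y⟩ * (σ * g)) = f (g * σ) := congrArg f (by ext <;> simp [σ, add_comm])
      simpa [hg] using h
    have hz : g.z = 0 := hker <| by
      rwa [show (⟨0, 0, g.z⟩ : Heisenberg p) = g by ext <;> simp [hx, hy]]
    ext <;> simpa
  have : Finite G := Nat.finite_of_card_ne_zero (by rw [hcard]; exact (pow_pos hp.pos 3).ne')
  exact ⟨(MulEquiv.ofBijective f
    ((Nat.bijective_iff_injective_and_card f).2 ⟨hinj, Heisenberg.natCard.trans hcard.symm⟩)).symm⟩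

end ExponentPrime

/-! ## Affine functions on the Heisenberg group -/

namespace Heisenberg

variable {p : ℕ} [Fact p.Prime]

/-- The third coordinate in exponential coordinates, in which automorphisms are linear. -/
def w (g : Heisenberg p) : ZMod p := g.z - g.x * g.y / 2

/-- The space of functions on the Heisenberg group that are affine in exponential coordinates. -/
def affineFunctions (p : ℕ) [Fact p.Prime] : Submodule (ZMod p) (Heisenberg p → ZMod p) :=
  LinearMap.range (Fintype.linearCombination (ZMod p)
    (![fun _ => 1, x, y, w] : Fin 4 → Heisenberg p → ZMod p))

theorem mem_affineFunctions {f : Heisenberg p → ZMod p} :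
    f ∈ affineFunctions p ↔
      ∃ a b c d : ZMod p, ∀ g, f g = a + b * g.x + c * g.y + d * g.w := by
  simp only [affineFunctions, LinearMap.mem_range, funext_iff]
  constructor
  · rintro ⟨v, hv⟩
    exact ⟨v 0, v 1, v 2, v 3, fun g => by
      simp [← hv g, Fintype.linearCombination_apply, Fin.sum_univ_four]⟩
  · rintro ⟨a, b, c, d, h⟩
    exact ⟨![a, b, c, d], fun g => by
      simp [h g, Fintype.linearCombination_apply, Fin.sum_univ_four]⟩

instance : Module.Finite (ZMod p) (affineFunctions p) :=
  inferInstanceAs (Module.Finite (ZMod p) (LinearMap.range _))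

theorem finrank_affineFunctions_le : Module.finrank (ZMod p) (affineFunctions p) ≤ 4 :=
  (LinearMap.finrank_range_le _).trans (by simp)

theorem w_mul (h2 : (2 : ZMod p) ≠ 0) (g h : Heisenberg p) :
    (g * h).w = g.w + h.w + (h.x * g.y - g.x * h.y) / 2 := by
  simp only [w, mul_x, mul_y, mul_z]
  field_simp
  ring

theorem eq_mul_x_add_mul_y_of_map_mul {f : Heisenberg p → ZMod p}
    (hf : ∀ g h, f (g * h) = f g + f h) (g : Heisenberg p) :
    f g = f σ * g.x + f τ * g.y := by
  have hlin (u : ZMod p → Heisenberg p) (hu : ∀ s t, u (s + t) = u s * u t) (t : ZMod p) :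
      f (u t) = f (u 1) * t := by
    let F : ZMod p →+ ZMod p := AddMonoidHom.mk' (fun t => f (u t)) fun s t => by rw [hu, hf]
    simpa [F, mul_comm] using ZMod.map_smul F t 1
  have hx := hlin (fun t => ⟨t, 0, 0⟩) (fun s t => by ext <;> simp) g.x
  have hy := hlin (fun t => ⟨0, t, 0⟩) (fun s t => by ext <;> simp) g.y
  have hz (t : ZMod p) : f ⟨0, 0, t⟩ = 0 := by
    have h : (⟨0, 0, t⟩ * (σ * ⟨0, t, 0⟩) : Heisenberg p) = ⟨0, t, 0⟩ * σ := by
      ext <;> simp [σ]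
    have h' := congrArg f h
    simp only [hf] at h'
    linear_combination h'
  have hg : g = ⟨0, 0, g.z⟩ * (⟨g.x, 0, 0⟩ * ⟨0, g.y, 0⟩) := by ext <;> simp
  rw [hg, hf, hf, hz, hx, hy]
  simp [σ, τ]

theorem comp_mulLeft_mem_affineFunctions (h2 : (2 : ZMod p) ≠ 0) (a : Heisenberg p)
    {f : Heisenberg p → ZMod p} (hf : f ∈ affineFunctions p) :
    (fun g => f (a * g)) ∈ affineFunctions p := by
  obtain ⟨r, s, t, u, h⟩ := mem_affineFunctions.1 hf
  refine mem_affineFunctions.2 ⟨r + s * a.x + t * a.y + u * a.w, s + u * a.y / 2,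
    t - u * a.x / 2, u, fun g => ?_⟩
  simp only [h, w_mul h2, mul_x, mul_y]
  ring

theorem comp_mulAut_mem_affineFunctions (h2 : (2 : ZMod p) ≠ 0) (φ : MulAut (Heisenberg p))
    {f : Heisenberg p → ZMod p} (hf : f ∈ affineFunctions p) :
    (fun g => f (φ g)) ∈ affineFunctions p := by
  have hx := eq_mul_x_add_mul_y_of_map_mul (f := fun g => (φ g).x) (by simp)
  have hy := eq_mul_x_add_mul_y_of_map_mul (f := fun g => (φ g).y) (by simp)
  have hw := eq_mul_x_add_mul_y_of_map_mul (f := fun g =>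
    (φ g).w - ((φ σ).x * (φ τ).y - (φ σ).y * (φ τ).x) * g.w) (fun g h => by
      have hxg := hx g
      have hxh := hx h
      have hyg := hy g
      have hyh := hy h
      rw [map_mul, w_mul h2, w_mul h2, hxg, hxh, hyg, hyh]
      ring)
  obtain ⟨r, s, t, u, h⟩ := mem_affineFunctions.1 hf
  set d := (φ σ).x * (φ τ).y - (φ σ).y * (φ τ).x
  refine mem_affineFunctions.2 ⟨r, s * (φ σ).x + t * (φ σ).y + u * ((φ σ).w - d * w σ),
    s * (φ τ).x + t * (φ τ).y + u * ((φ τ).w - d * w τ), u * d, fun g => ?_⟩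
  rw [h]
  linear_combination s * hx g + t * hy g + u * hw g

/-- The permutations of the Heisenberg group preserving the space of affine functions. -/
def affinePerm (p : ℕ) [Fact p.Prime] : Subgroup (Equiv.Perm (Heisenberg p)) where
  carrier := {π | ∀ f, f ∘ π ∈ affineFunctions p ↔ f ∈ affineFunctions p}
  one_mem' _ := Iff.rfl
  mul_mem' {π ψ} hπ hψ f := (hψ (f ∘ π)).trans (hπ f)
  inv_mem' {π} hπ f := by
    rw [← hπ, Function.comp_assoc]
    rw [← Equiv.Perm.coe_mul, inv_mul_cancel, Equiv.Perm.coe_one, Function.comp_id]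

theorem hol_le_affinePerm (h2 : (2 : ZMod p) ≠ 0) : Hol p ≤ affinePerm p := by
  refine sup_le ?_ ?_
  · rintro _ ⟨a, rfl⟩
    refine fun f => ⟨fun h => ?_, comp_mulLeft_mem_affineFunctions h2 a⟩
    simpa [leftMulHom] using comp_mulLeft_mem_affineFunctions h2 a⁻¹ h
  · rintro _ ⟨φ, rfl⟩
    refine fun f => ⟨fun h => ?_, comp_mulAut_mem_affineFunctions h2 φ⟩
    have hf : (fun g => (f ∘ MulAut.toPerm (Heisenberg p) φ) (φ⁻¹ g)) = f :=
      funext fun g => congrArg f (φ.apply_symm_apply g)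
    exact hf ▸ comp_mulAut_mem_affineFunctions h2 φ⁻¹ h

theorem pow_prime_eq_one_of_mem_affinePerm (h3 : 3 < p) {π : Equiv.Perm (Heisenberg p)}
    (hπ : π ∈ affinePerm p) {k : ℕ} (hk : π ^ p ^ k = 1) : π ^ p = 1 := by
  let T : Module.End (ZMod p) (affineFunctions p) :=
    (LinearMap.funLeft (ZMod p) (ZMod p) π).restrict fun f hf => (hπ f).2 hf
  have hT (n : ℕ) (f : affineFunctions p) :
      ((T ^ n) f : Heisenberg p → ZMod p) = f ∘ ⇑(π ^ n) := by
    induction n with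
    | zero => rfl
    | succ n ih => rw [pow_succ', Module.End.mul_apply, pow_succ, Equiv.Perm.coe_mul,
        ← Function.comp_assoc, ← ih]; rfl
  have hTp : T ^ p = 1 := Module.End.pow_prime_eq_one_of_pow_prime_pow_eq_one
    (finrank_affineFunctions_le.trans h3) T (k := k) (by
      ext1 f
      exact Subtype.ext (by rw [hT, hk]; rfl))
  have key {f : Heisenberg p → ZMod p} (hf : f ∈ affineFunctions p) (g : Heisenberg p) :
      f ((π ^ p) g) = f g := by
    have h := hT p ⟨f, hf⟩
    rw [hTp] at h
    exact (congrFun h g).symm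
  ext1 g
  have hx : ((π ^ p) g).x = g.x := key (mem_affineFunctions.2 ⟨0, 1, 0, 0, by simp⟩) g
  have hy : ((π ^ p) g).y = g.y := key (mem_affineFunctions.2 ⟨0, 0, 1, 0, by simp⟩) g
  have hw : ((π ^ p) g).w = g.w := key (mem_affineFunctions.2 ⟨0, 0, 0, 1, by simp⟩) g
  refine Heisenberg.ext hx hy ?_
  simpa [w, hx, hy] using hw

end Heisenberg

/-! ## Groups that do not have exponent `p` -/

theorem IsRegularSub.natCard_eq {X : Type*} [Nonempty X] {H : Subgroup (Equiv.Perm X)}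
    (hH : IsRegularSub H) : Nat.card H = Nat.card X := by
  obtain ⟨x⟩ := ‹Nonempty X›
  refine Nat.card_congr (Equiv.ofBijective (fun g : H => (g : Equiv.Perm X) x) ⟨?_, ?_⟩)
  · intro g h hgh
    exact Subtype.ext ((hH x (h.1 x)).unique ⟨g.2, hgh⟩ ⟨h.2, rfl⟩)
  · intro y
    obtain ⟨g, ⟨hg, hgx⟩, -⟩ := hH x y
    exact ⟨⟨g, hg⟩, hgx⟩

theorem ZMod.nsmul_one_ne_zero_of_lt {m n : ℕ} (hm : m ≠ 0) (hmn : m < n) :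
    m • (1 : ZMod n) ≠ 0 := by
  rw [nsmul_one, Ne, ZMod.natCast_eq_zero_iff]
  exact fun h => hmn.not_ge (Nat.le_of_dvd (Nat.pos_of_ne_zero hm) h)

theorem ExtraspecialPresented.exists_pow_prime_ne_one (p : ℕ) [Fact p.Prime] :
    ∃ g : ExtraspecialPresented p, g ^ p ≠ 1 := by
  have hp : p.Prime := Fact.out
  have hu : (1 + p : ZMod (p ^ 2)) ^ p = 1 := by
    have h := dvd_sub_pow_of_dvd_sub (p := p) (a := (1 + p : ZMod (p ^ 2))) (b := 1) (by simp) 1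
    have h0 : (p : ZMod (p ^ 2)) ^ 2 = 0 := by exact_mod_cast ZMod.natCast_self (p ^ 2)
    simpa [h0, sub_eq_zero] using h
  let u : (ZMod (p ^ 2))ˣ := Units.ofPowEqOne _ p hu hp.ne_zero
  let s : Equiv.Perm (ZMod (p ^ 2)) := Equiv.addRight 1
  have hs (n : ℕ) (x : ZMod (p ^ 2)) : (s ^ n) x = x + n := by
    simp [s]
  have ht (n : ℕ) (x : ZMod (p ^ 2)) : (Units.mulLeft u ^ n) x = (1 + p) ^ n * x := by
    induction n with
    | zero => simp
    | succ n ih => simp [pow_succ', Equiv.Perm.mul_apply, ih, u, mul_assoc]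
  let F : ExtraspecialPresented p →* Equiv.Perm (ZMod (p ^ 2)) :=
    PresentedGroup.toGroup (f := ![s, Units.mulLeft u]) (by
      rintro r (rfl | rfl | rfl)
      · ext1 x
        simp [hs, -Nat.cast_pow]
      · ext1 x
        simp [ht, hu]
      · simp only [map_mul, map_inv, map_pow, FreeGroup.lift_apply_of, Matrix.cons_val_zero,
          Matrix.cons_val_one]
        rw [mul_inv_eq_one, mul_inv_eq_iff_eq_mul]
        ext1 x
        have ht1 (y : ZMod (p ^ 2)) := ht 1 y
        have hs1 (y : ZMod (p ^ 2)) := hs 1 y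
        simp only [pow_one] at ht1 hs1
        simp only [Equiv.Perm.mul_apply, ht1, hs1, hs]
        push_cast
        ring)
  refine ⟨PresentedGroup.of 0, fun h => ?_⟩
  have hF : s ^ p = 1 := by
    rw [← map_one F, ← h, map_pow]
    simp [F]
  have h0 := hs p 0
  rw [hF] at h0
  exact ZMod.nsmul_one_ne_zero_of_lt (n := p ^ 2) hp.ne_zero
    (lt_self_pow₀ hp.one_lt (by norm_num)) (by simpa using h0.symm)

/-- Every regular subgroup of `Hol(M₁)` is isomorphic either to `M₁` or to the
elementary abelian group `(ZMod p)³`; in particular none is isomorphic to `C_{p³}`, to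
`C_{p²} × C_p`, or to the extraspecial group `C_{p²} ⋊ C_p` of exponent `p²`. -/
theorem regular_subgroups_of_Hol_M1_iso_type (p : ℕ) [Fact p.Prime] (h3 : 3 < p) :
    ∀ G : Subgroup (Equiv.Perm (Heisenberg p)), G ≤ Hol p → IsRegularSub G →
      (Nonempty (G ≃* Heisenberg p) ∨
        Nonempty (G ≃* Multiplicative (ZMod p × ZMod p × ZMod p))) ∧
      IsEmpty (G ≃* Multiplicative (ZMod (p ^ 3))) ∧
      IsEmpty (G ≃* Multiplicative (ZMod (p ^ 2) × ZMod p)) ∧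
      IsEmpty (G ≃* ExtraspecialPresented p) := by
  intro G hG hreg
  have hp : p.Prime := Fact.out
  have h2 : (2 : ZMod p) ≠ 0 := by
    simpa using ZMod.nsmul_one_ne_zero_of_lt (m := 2) (n := p) two_ne_zero (by omega)
  have hcard : Nat.card G = p ^ 3 := by
    have : Nonempty (Heisenberg p) := ⟨1⟩
    rw [hreg.natCard_eq, Heisenberg.natCard]
  have hexp (g : G) : g ^ p = 1 := by
    have h : g ^ p ^ 3 = 1 := hcard ▸ pow_card_eq_one'
    exact Subtype.ext (pow_prime_eq_one_of_mem_affinePerm h3 (hol_le_affinePerm h2 (hG g.2))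
      (congrArg Subtype.val h))
  have hexp' {M : Type} [Group M] (e : G ≃* M) (m : M) : m ^ p = 1 := by
    rw [← e.apply_symm_apply m, ← map_pow, hexp, map_one]
  refine ⟨?_, ⟨fun e => ?_⟩, ⟨fun e => ?_⟩, ⟨fun e => ?_⟩⟩
  · by_cases hcomm : ∀ a b : G, a * b = b * a
    · exact .inr (nonempty_mulEquiv_of_comm_of_pow_prime_eq_one hcard hexp hcomm)
    · exact .inl (nonempty_mulEquiv_heisenberg_of_pow_prime_eq_one hcard hexp hcomm)
  · exact ZMod.nsmul_one_ne_zero_of_lt (n := p ^ 3) hp.ne_zero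
      (lt_self_pow₀ hp.one_lt (by norm_num))
      (congrArg Multiplicative.toAdd (hexp' e (Multiplicative.ofAdd 1)))
  · exact ZMod.nsmul_one_ne_zero_of_lt (n := p ^ 2) hp.ne_zero
      (lt_self_pow₀ hp.one_lt (by norm_num))
      (congrArg (fun m => m.toAdd.1) (hexp' e (Multiplicative.ofAdd (1, 0))))
  · obtain ⟨g, hg⟩ := ExtraspecialPresented.exists_pow_prime_ne_one p
    exact hg (hexp' e g)
end
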